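/- (Interpolation paths as ODE solutions) In the (t,R)-parametrized model, define F_v(t,R) = E⟨Q_v⟩_{t,R} and F_u(t,R) = 2ρ_u φ₀'(α_v ρ_u E⟨Q_v⟩_{t,R}) where φ₀(m) = (m − ln(1+m))/2. For every ε ∈ [0,∞)² there exists a unique global solution R(·,ε) : [0,1] → [0,∞)² of the ODE g' = (F_u(t,g), F_v(t,g)) with g(0) = ε; this solution is continuously differentiable and its derivative satisfies R'(t,ε) ∈ [0,ρ_u]×[0,ρ_v] for all t ∈ [0,1]. Moreover, for every t ∈ [0,1], the map ε ↦ R(t,ε) is a C¹-diffeomorphism from [0,∞)² onto its image whose Jacobian determinant satisfies det J_{R(t,·)}(ε) ≥ 1 for all ε ∈ [0,∞)². The same statement holds for the ODE g' = (m_u, F_v(t,g)), g(0) = ε, for any fixed m_u ∈ [0,ρ_u]. -/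

import Mathlib

open MeasureTheory Real Filter Set

noncomputable section

/-- i.i.d. standard Gaussian measure on `Fin n → ℝ`. -/
def stdGaussian (n : ℕ) : Measure (Fin n → ℝ) :=
  Measure.pi fun _ : Fin n => ProbabilityTheory.gaussianReal 0 1

/-- i.i.d. standard Gaussian measure on matrices `Fin p → Fin q → ℝ`. -/
def stdGaussianMat (p q : ℕ) : Measure (Fin p → Fin q → ℝ) :=
  Measure.pi fun _ : Fin p => stdGaussian q

/-- `P` is the uniform (rotation-invariant) probability measure on the sphere of
radius `r` centered at the origin in `ℝⁿ`. -/
def IsUniformSphere (n : ℕ) (r : ℝ) (P : Measure (Fin n → ℝ)) : Prop :=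
  IsProbabilityMeasure P ∧
  (∀ᵐ x ∂P, ∑ i, (x i) ^ 2 = r ^ 2) ∧
  ∀ O : Matrix (Fin n) (Fin n) ℝ, O ∈ Matrix.orthogonalGroup (Fin n) ℝ →
    P.map (fun x => O.mulVec x) = P

/-- The interpolating Hamiltonian `H_{t,R}(u,v)`, with the observations
`Y^{(t)} = √((1−t)/n) U Vᵀ + Z`, `Ỹ = √(α_v R_v) U + Z̃`, `Ȳ = √(α_u R_u) V + Z̄`
substituted. -/
def interpH (n nu nv : ℕ) (au av t Ru Rv : ℝ)
    (U : Fin nu → ℝ) (V : Fin nv → ℝ) (Z : Fin nu → Fin nv → ℝ)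
    (Zt : Fin nu → ℝ) (Zb : Fin nv → ℝ)
    (u : Fin nu → ℝ) (v : Fin nv → ℝ) : ℝ :=
  (∑ i, ∑ j, ((1 - t) / (2 * n) * (u i) ^ 2 * (v j) ^ 2
      - Real.sqrt ((1 - t) / n) * u i * v j
          * (Real.sqrt ((1 - t) / n) * U i * V j + Z i j)))
  + (∑ i, (av * Rv / 2 * (u i) ^ 2
      - Real.sqrt (av * Rv) * u i * (Real.sqrt (av * Rv) * U i + Zt i)))
  + (∑ j, (au * Ru / 2 * (v j) ^ 2
      - Real.sqrt (au * Ru) * v j * (Real.sqrt (au * Ru) * V j + Zb j)))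

/-- The partition function `Z_{t,R} = ∫∫ e^{−H_{t,R}(u,v)} dP_u(u) dP_v(v)`. -/
def partFun (n nu nv : ℕ) (au av t Ru Rv : ℝ)
    (Pu : Measure (Fin nu → ℝ)) (Pv : Measure (Fin nv → ℝ))
    (U : Fin nu → ℝ) (V : Fin nv → ℝ) (Z : Fin nu → Fin nv → ℝ)
    (Zt : Fin nu → ℝ) (Zb : Fin nv → ℝ) : ℝ :=
  ∫ u, (∫ v, Real.exp (-(interpH n nu nv au av t Ru Rv U V Z Zt Zb u v)) ∂Pv) ∂Pu

/-- The Gibbs bracket `⟨f⟩_{t,R}`, i.e. the expectation of `f(u,v)` under the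
posterior measure proportional to `e^{−H_{t,R}(u,v)} dP_u(u) dP_v(v)`. -/
def gibbs (n nu nv : ℕ) (au av t Ru Rv : ℝ)
    (Pu : Measure (Fin nu → ℝ)) (Pv : Measure (Fin nv → ℝ))
    (U : Fin nu → ℝ) (V : Fin nv → ℝ) (Z : Fin nu → Fin nv → ℝ)
    (Zt : Fin nu → ℝ) (Zb : Fin nv → ℝ)
    (f : (Fin nu → ℝ) → (Fin nv → ℝ) → ℝ) : ℝ :=
  (∫ u, (∫ v, f u v * Real.exp (-(interpH n nu nv au av t Ru Rv U V Z Zt Zb u v)) ∂Pv) ∂Pu)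
    / partFun n nu nv au av t Ru Rv Pu Pv U V Z Zt Zb

/-- Expectation `E` over all the randomness `U ~ P_u`, `V ~ P_v` and the independent
standard Gaussian noises `Z, Z̃, Z̄`. -/
def Efull (nu nv : ℕ)
    (Pu : Measure (Fin nu → ℝ)) (Pv : Measure (Fin nv → ℝ))
    (g : (Fin nu → ℝ) → (Fin nv → ℝ) → (Fin nu → Fin nv → ℝ) →
      (Fin nu → ℝ) → (Fin nv → ℝ) → ℝ) : ℝ :=
  ∫ U, (∫ V, (∫ Z, (∫ Zt, (∫ Zb, g U V Z Zt Zb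
    ∂(stdGaussian nv)) ∂(stdGaussian nu)) ∂(stdGaussianMat nu nv)) ∂Pv) ∂Pu

/-- The average interpolating free entropy `fₙ(t,R) = (1/n) E ln Z_{t,R}`. -/
def interpFreeEntropy (n nu nv : ℕ) (au av t Ru Rv : ℝ)
    (Pu : Measure (Fin nu → ℝ)) (Pv : Measure (Fin nv → ℝ)) : ℝ :=
  (1 / (n : ℝ)) * Efull nu nv Pu Pv (fun U V Z Zt Zb =>
    Real.log (partFun n nu nv au av t Ru Rv Pu Pv U V Z Zt Zb))

/-- The overlap `Q_u = (1/n_u) Σ_i u_i U_i`. -/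
def overlapU (nu : ℕ) (u U : Fin nu → ℝ) : ℝ := (1 / (nu : ℝ)) * ∑ i, u i * U i

/-- The overlap `Q_v = (1/n_v) Σ_j v_j V_j`. -/
def overlapV (nv : ℕ) (v V : Fin nv → ℝ) : ℝ := (1 / (nv : ℝ)) * ∑ j, v j * V j

/-- `E⟨Q_v⟩_{t,R}`. -/
def eQv (n nu nv : ℕ) (au av t Ru Rv : ℝ)
    (Pu : Measure (Fin nu → ℝ)) (Pv : Measure (Fin nv → ℝ)) : ℝ :=
  Efull nu nv Pu Pv (fun U V Z Zt Zb =>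
    gibbs n nu nv au av t Ru Rv Pu Pv U V Z Zt Zb (fun _ v => overlapV nv v V))

/-- `E⟨Q_u⟩_{t,R}`. -/
def eQu (n nu nv : ℕ) (au av t Ru Rv : ℝ)
    (Pu : Measure (Fin nu → ℝ)) (Pv : Measure (Fin nv → ℝ)) : ℝ :=
  Efull nu nv Pu Pv (fun U V Z Zt Zb =>
    gibbs n nu nv au av t Ru Rv Pu Pv U V Z Zt Zb (fun u _ => overlapU nu u U))

/-- The quantity `𝓛 = (1/n) Σ_j [(α_u/2)v_j² − α_u v_j V_j − (1/2)√(α_u/R_u) v_j Z̄_j]`. -/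
def calL (n nv : ℕ) (au Ru : ℝ) (v V Zb : Fin nv → ℝ) : ℝ :=
  (1 / (n : ℝ)) * ∑ j, (au / 2 * (v j) ^ 2 - au * v j * V j
    - 1 / 2 * Real.sqrt (au / Ru) * v j * Zb j)

/-- `E⟨𝓛⟩_{t,R}`. -/
def eL (n nu nv : ℕ) (au av t Ru Rv : ℝ)
    (Pu : Measure (Fin nu → ℝ)) (Pv : Measure (Fin nv → ℝ)) : ℝ :=
  Efull nu nv Pu Pv (fun U V Z Zt Zb =>
    gibbs n nu nv au av t Ru Rv Pu Pv U V Z Zt Zb (fun _ v => calL n nv au Ru v V Zb))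

/-- `φ₀(m) = (m − ln(1+m))/2`. -/
def phi0 (m : ℝ) : ℝ := (m - Real.log (1 + m)) / 2


/-- The nonnegative quadrant `[0,∞)²`. -/
def quadrant : Set (ℝ × ℝ) := {p : ℝ × ℝ | 0 ≤ p.1 ∧ 0 ≤ p.2}

/-- `φ₀'(m) = m/(2(1+m))`, the derivative of `φ₀(m) = (m − ln(1+m))/2`. -/
def phi0' (m : ℝ) : ℝ := m / (2 * (1 + m))

/-- The conclusion of Proposition 2 for a time-dependent vector field `G` on `ℝ²`:
for every initial condition `ε ∈ [0,∞)²` the ODE `g' = G(t,g)`, `g(0) = ε` has a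
unique global solution `R(·,ε) : [0,1] → [0,∞)²`; it is continuously differentiable
with derivative in the box `[0,ρ_u] × [0,ρ_v]`; and for every `t ∈ [0,1]` the flow
map `ε ↦ R(t,ε)` is a `C¹`-diffeomorphism from `[0,∞)²` onto its image whose
Jacobian determinant is `≥ 1` everywhere. -/
def ODEConclusion (pu pv : ℝ) (G : ℝ → ℝ × ℝ → ℝ × ℝ) : Prop :=
  ∃ Rsol : ℝ × ℝ → ℝ → ℝ × ℝ,
    (∀ eps ∈ quadrant,
      Rsol eps 0 = eps ∧
      (∀ t ∈ Icc (0:ℝ) 1, Rsol eps t ∈ quadrant) ∧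
      (∀ t ∈ Icc (0:ℝ) 1,
        HasDerivWithinAt (Rsol eps) (G t (Rsol eps t)) (Icc (0:ℝ) 1) t) ∧
      ContinuousOn (fun t => G t (Rsol eps t)) (Icc (0:ℝ) 1) ∧
      (∀ t ∈ Icc (0:ℝ) 1, G t (Rsol eps t) ∈ Icc (0:ℝ) pu ×ˢ Icc (0:ℝ) pv)) ∧
    (∀ eps ∈ quadrant, ∀ g : ℝ → ℝ × ℝ, g 0 = eps →
      (∀ t ∈ Icc (0:ℝ) 1, g t ∈ quadrant) →
      (∀ t ∈ Icc (0:ℝ) 1, HasDerivWithinAt g (G t (g t)) (Icc (0:ℝ) 1) t) →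
      Set.EqOn g (Rsol eps) (Icc (0:ℝ) 1)) ∧
    (∀ t ∈ Icc (0:ℝ) 1,
      Set.InjOn (fun eps => Rsol eps t) quadrant ∧
      (∃ D : ℝ × ℝ → (ℝ × ℝ) →L[ℝ] (ℝ × ℝ),
        (∀ eps ∈ quadrant,
          HasFDerivWithinAt (fun eps' => Rsol eps' t) (D eps) quadrant eps) ∧
        ContinuousOn D quadrant ∧
        (∀ eps ∈ quadrant, 1 ≤ LinearMap.det ((D eps) : (ℝ × ℝ) →ₗ[ℝ] (ℝ × ℝ))) ∧
        (∃ (ψ : ℝ × ℝ → ℝ × ℝ) (Dψ : ℝ × ℝ → (ℝ × ℝ) →L[ℝ] (ℝ × ℝ)),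
          (∀ eps ∈ quadrant, ψ (Rsol eps t) = eps) ∧
          (∀ y ∈ (fun eps => Rsol eps t) '' quadrant,
            HasFDerivWithinAt ψ (Dψ y) ((fun eps => Rsol eps t) '' quadrant) y) ∧
          ContinuousOn Dψ ((fun eps => Rsol eps t) '' quadrant))))


/-! ### Flows of planar vector fields on the quadrant -/

theorem convex_quadrant : Convex ℝ quadrant := by
  have : quadrant = Ici (0 : ℝ) ×ˢ Ici (0 : ℝ) := by
    ext p; simp [quadrant, Prod.le_def]
  rw [this]
  exact (convex_Ici _).prod (convex_Ici _)

theorem HasDerivWithinAt.Ici_of_Icc {E : Type*} [NormedAddCommGroup E] [NormedSpace ℝ E]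
    {f : ℝ → E} {f' : E} {a b t : ℝ} (h : HasDerivWithinAt f f' (Icc a b) t)
    (ht : t ∈ Ico a b) : HasDerivWithinAt f f' (Ici t) t := by
  refine (h.mono (Icc_subset_Icc_left ht.1)).mono_of_mem_nhdsWithin ?_
  exact Icc_mem_nhdsGE ht.2

/-- A function with nonnegative derivative on `[0,1]` is nondecreasing there. -/
theorem monotoneOn_Icc_of_hasDerivWithinAt {f f' : ℝ → ℝ}
    (h : ∀ t ∈ Icc (0 : ℝ) 1, HasDerivWithinAt f (f' t) (Icc 0 1) t)
    (h0 : ∀ t ∈ Icc (0 : ℝ) 1, 0 ≤ f' t) : MonotoneOn f (Icc 0 1) := by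
  refine monotoneOn_of_hasDerivWithinAt_nonneg (f' := f') (convex_Icc 0 1)
    (fun t ht => (h t ht).continuousWithinAt) (fun t ht => ?_) (fun t ht => ?_)
  · exact (h t (interior_subset ht)).mono interior_subset
  · exact h0 t (interior_subset ht)

/-- The projection `(a, b) ↦ (a⁺, b⁺)` onto the quadrant. -/
def quadrantProj (p : ℝ × ℝ) : ℝ × ℝ := (max 0 p.1, max 0 p.2)

theorem lipschitzWith_quadrantProj : LipschitzWith 1 quadrantProj := by
  have h1 : LipschitzWith 1 (fun p : ℝ × ℝ => max 0 p.1) := LipschitzWith.prod_fst.const_max 0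
  have h2 : LipschitzWith 1 (fun p : ℝ × ℝ => max 0 p.2) := LipschitzWith.prod_snd.const_max 0
  exact (max_self (1 : NNReal)) ▸ h1.prodMk h2

theorem quadrantProj_mem (p : ℝ × ℝ) : quadrantProj p ∈ quadrant :=
  ⟨le_max_left _ _, le_max_left _ _⟩

theorem quadrantProj_eq_self {p : ℝ × ℝ} (hp : p ∈ quadrant) : quadrantProj p = p :=
  Prod.ext (max_eq_right hp.1) (max_eq_right hp.2)

/-- Coordinatewise truncation of a vector to `[-M, M]²`. -/
def truncate (M : ℝ) (p : ℝ × ℝ) : ℝ × ℝ := (max (-M) (min M p.1), max (-M) (min M p.2))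

theorem lipschitzWith_truncate (M : ℝ) : LipschitzWith 1 (truncate M) := by
  have h1 : LipschitzWith 1 (fun p : ℝ × ℝ => max (-M) (min M p.1)) :=
    (LipschitzWith.prod_fst.const_min M).const_max (-M)
  have h2 : LipschitzWith 1 (fun p : ℝ × ℝ => max (-M) (min M p.2)) :=
    (LipschitzWith.prod_snd.const_min M).const_max (-M)
  exact (max_self (1 : NNReal)) ▸ h1.prodMk h2

theorem norm_truncate_le {M : ℝ} (hM : 0 ≤ M) (p : ℝ × ℝ) : ‖truncate M p‖ ≤ M := by
  have h : ∀ a : ℝ, |max (-M) (min M a)| ≤ M := fun a =>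
    abs_le.2 ⟨le_max_left _ _, max_le (by linarith) (min_le_left _ _)⟩
  exact max_le (h _) (h _)

theorem truncate_eq_self {M : ℝ} {p : ℝ × ℝ} (hp : ‖p‖ ≤ M) : truncate M p = p := by
  have h : ∀ a : ℝ, |a| ≤ M → max (-M) (min M a) = a := fun a ha => by
    rw [min_eq_right (abs_le.1 ha).2, max_eq_right (abs_le.1 ha).1]
  exact Prod.ext (h _ ((norm_fst_le p).trans hp)) (h _ ((norm_snd_le p).trans hp))

theorem norm_truncate_le_norm {M : ℝ} (hM : 0 ≤ M) (p : ℝ × ℝ) : ‖truncate M p‖ ≤ ‖p‖ := by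
  have h := (lipschitzWith_truncate M).dist_le_mul p 0
  have h0 : truncate M (0 : ℝ × ℝ) = 0 := truncate_eq_self (by simpa using hM)
  simpa [h0, dist_zero_right] using h

/-- Existence for linear ODEs on `[0,1]`. -/
theorem exists_linear_ode_solution {A : ℝ → (ℝ × ℝ) →L[ℝ] (ℝ × ℝ)} {K : NNReal}
    (hA : ContinuousOn A (Icc 0 1)) (hK : ∀ t, ‖A t‖ ≤ K) (x₀ : ℝ × ℝ) :
    ∃ p : ℝ → ℝ × ℝ, p 0 = x₀ ∧
      (∀ t ∈ Icc (0 : ℝ) 1, HasDerivWithinAt p (A t (p t)) (Icc 0 1) t) ∧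
      ∀ t ∈ Icc (0 : ℝ) 1, ‖p t‖ ≤ ‖x₀‖ * exp K := by
  set M : NNReal := ‖x₀‖₊ * ⟨exp K, (exp_pos _).le⟩ with hM
  have hMr : (M : ℝ) = ‖x₀‖ * exp K := rfl
  have hPL : IsPicardLindelof (fun t x => A t (truncate M x)) (tmin := 0) (tmax := 1)
      ⟨0, by simp⟩ x₀ (K * M) 0 (K * M) K := by
    refine ⟨fun t _ => ?_, fun x _ => ?_, fun t _ x _ => ?_, by simp⟩
    · have h1 : LipschitzWith K (A t) :=
        (A t).lipschitz.weaken (by exact_mod_cast hK t)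
      exact (mul_one K ▸ h1.comp (lipschitzWith_truncate M)).lipschitzOnWith
    · exact hA.clm_apply continuousOn_const
    · calc ‖A t (truncate M x)‖ ≤ ‖A t‖ * ‖truncate M x‖ := (A t).le_opNorm _
        _ ≤ K * M := by
          gcongr
          · exact hK t
          · exact norm_truncate_le M.2 x
        _ = _ := by push_cast; rfl
  obtain ⟨p, hp0, hp⟩ := hPL.exists_eq_forall_mem_Icc_hasDerivWithinAt₀
  have hb : ∀ t ∈ Icc (0 : ℝ) 1, ‖p t‖ ≤ ‖x₀‖ * exp K := by
    intro t ht
    have h1 := norm_le_gronwallBound_of_norm_deriv_right_le (f := p) (K := K) (ε := 0)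
      (δ := ‖x₀‖) (fun t ht => (hp t ht).continuousWithinAt)
      (fun t ht => (hp t (Ico_subset_Icc_self ht)).Ici_of_Icc ht) (by rw [← hp0])
      (fun t _ => by
        rw [add_zero]
        refine ((A t).le_opNorm _).trans ?_
        gcongr
        · exact hK t
        · exact norm_truncate_le_norm M.2 _) t ht
    rw [gronwallBound_ε0] at h1
    refine h1.trans ?_
    gcongr
    nlinarith [ht.2, K.2]
  refine ⟨p, hp0, fun t ht => ?_, hb⟩
  have := hp t ht
  rwa [truncate_eq_self (hMr ▸ hb t ht)] at this

/-- A solution on `[0,1]` of a linear scalar equation `d' = τ d` with `τ ≥ 0` and `d 0 = 1` stays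
above `1`. -/
theorem one_le_of_hasDerivWithinAt_mul {d τ : ℝ → ℝ} (h0 : d 0 = 1)
    (hd : ∀ t ∈ Icc (0 : ℝ) 1, HasDerivWithinAt d (τ t * d t) (Icc 0 1) t)
    (hτ : ∀ t ∈ Icc (0 : ℝ) 1, 0 ≤ τ t) {t : ℝ} (ht : t ∈ Icc (0 : ℝ) 1) : 1 ≤ d t := by
  have hsq : ∀ s ∈ Icc (0 : ℝ) 1, 1 ≤ d s ^ 2 := by
    have hm : MonotoneOn (fun s => d s ^ 2) (Icc 0 1) := by
      refine monotoneOn_Icc_of_hasDerivWithinAt (f' := fun s => 2 * τ s * d s ^ 2)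
        (fun s hs => ?_) (fun s hs => ?_)
      · have h := (hd s hs).mul (hd s hs)
        simp only [sq]
        exact h.congr_deriv (by ring)
      · have := hτ s hs
        positivity
    intro s hs
    have := hm (left_mem_Icc.2 zero_le_one) hs hs.1
    simpa [h0] using this
  have hpos : 0 ≤ d t := by
    by_contra! hneg
    have hc : ContinuousOn d (Icc 0 t) := fun s hs =>
      ((hd s ⟨hs.1, hs.2.trans ht.2⟩).continuousWithinAt).mono (Icc_subset_Icc_right ht.2)
    obtain ⟨s, hs, hs0⟩ := intermediate_value_Icc' ht.1 hc
      (show (0 : ℝ) ∈ Icc (d t) (d 0) from ⟨hneg.le, by simp [h0]⟩)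
    have := hsq s ⟨hs.1, hs.2.trans ht.2⟩
    norm_num [hs0] at this
  nlinarith [hsq t ht]

theorem det_clm_prod (L : (ℝ × ℝ) →L[ℝ] (ℝ × ℝ)) :
    LinearMap.det (L : (ℝ × ℝ) →ₗ[ℝ] (ℝ × ℝ)) =
      (L (1, 0)).1 * (L (0, 1)).2 - (L (0, 1)).1 * (L (1, 0)).2 := by
  rw [← LinearMap.det_toMatrix (Module.Basis.finTwoProd ℝ), Matrix.det_fin_two]
  simp [LinearMap.toMatrix_apply]

theorem clm_prod_apply (L : (ℝ × ℝ) →L[ℝ] (ℝ × ℝ)) (x : ℝ × ℝ) :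
    L x = x.1 • L (1, 0) + x.2 • L (0, 1) := by
  rw [← map_smul, ← map_smul, ← map_add]
  simp

/-- The linear map of the plane with columns `p` and `q`. -/
def ofColumns (p q : ℝ × ℝ) : (ℝ × ℝ) →L[ℝ] (ℝ × ℝ) :=
  (ContinuousLinearMap.fst ℝ ℝ ℝ).smulRight p + (ContinuousLinearMap.snd ℝ ℝ ℝ).smulRight q

theorem ofColumns_apply (p q x : ℝ × ℝ) : ofColumns p q x = x.1 • p + x.2 • q := rfl

theorem Continuous.ofColumns : Continuous fun z : (ℝ × ℝ) × (ℝ × ℝ) => ofColumns z.1 z.2 := by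
  have h : ∀ c : (ℝ × ℝ) →L[ℝ] ℝ, Continuous fun v : ℝ × ℝ => c.smulRight v := fun c =>
    (ContinuousLinearMap.smulRightL ℝ (ℝ × ℝ) (ℝ × ℝ) c).continuous
  exact ((h _).comp continuous_fst).add ((h _).comp continuous_snd)

/-- A bounded `C¹` time-dependent vector field on the quadrant, with nonnegative components and
nonnegative divergence. -/
structure QuadrantField (pu pv : ℝ) (G : ℝ → ℝ × ℝ → ℝ × ℝ)
    (DG : ℝ → ℝ × ℝ → (ℝ × ℝ) →L[ℝ] (ℝ × ℝ)) (K : NNReal) : Prop where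
  continuous : Continuous (Function.uncurry G)
  mem_box : ∀ t R, G t R ∈ Icc 0 pu ×ˢ Icc 0 pv
  hasFDerivWithinAt : ∀ t, ∀ R ∈ quadrant, HasFDerivWithinAt (G t) (DG t R) quadrant R
  continuous_deriv : Continuous (Function.uncurry DG)
  norm_deriv_le : ∀ t R, ‖DG t R‖ ≤ K
  trace_nonneg : ∀ t R, 0 ≤ (DG t R (1, 0)).1 + (DG t R (0, 1)).2

namespace QuadrantField

variable {pu pv : ℝ} {G : ℝ → ℝ × ℝ → ℝ × ℝ} {DG : ℝ → ℝ × ℝ → (ℝ × ℝ) →L[ℝ] (ℝ × ℝ)}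
  {K : NNReal}

theorem lipschitzOnWith (h : QuadrantField pu pv G DG K) (t : ℝ) :
    LipschitzOnWith K (G t) quadrant :=
  convex_quadrant.lipschitzOnWith_of_nnnorm_hasFDerivWithin_le
    (fun R hR => h.hasFDerivWithinAt t R hR) (fun R _ => h.norm_deriv_le t R)

/-- `R` solves the ODE `R' = G(t, R)` on `[0,1]` and stays in the quadrant. -/
def IsSolution (G : ℝ → ℝ × ℝ → ℝ × ℝ) (R : ℝ → ℝ × ℝ) : Prop :=
  (∀ t ∈ Icc (0 : ℝ) 1, R t ∈ quadrant) ∧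
    ∀ t ∈ Icc (0 : ℝ) 1, HasDerivWithinAt R (G t (R t)) (Icc 0 1) t

theorem IsSolution.continuousOn {R : ℝ → ℝ × ℝ} (hR : IsSolution G R) :
    ContinuousOn R (Icc 0 1) := fun t ht => (hR.2 t ht).continuousWithinAt

theorem exists_isSolution (h : QuadrantField pu pv G DG K) {eps : ℝ × ℝ} (heps : eps ∈ quadrant) :
    ∃ R : ℝ → ℝ × ℝ, R 0 = eps ∧ IsSolution G R := by
  set M : NNReal := max pu.toNNReal pv.toNNReal
  have hPL : IsPicardLindelof (fun t x => G t (quadrantProj x)) (tmin := 0) (tmax := 1)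
      ⟨0, by simp⟩ eps M 0 M K := by
    refine ⟨fun t _ => ?_, fun x _ => ?_, fun t _ x _ => ?_, by simp⟩
    · have h1 := (h.lipschitzOnWith t).comp (s := univ)
        (lipschitzWith_quadrantProj.lipschitzOnWith (s := univ))
        (fun x _ => quadrantProj_mem x)
      rw [mul_one] at h1
      exact h1.mono (subset_univ _)
    · exact (h.continuous.comp (continuous_id.prodMk continuous_const)).continuousOn
    · obtain ⟨h1, h2⟩ := h.mem_box t (quadrantProj x)
      refine max_le ?_ ?_
      · rw [norm_eq_abs, abs_of_nonneg h1.1]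
        exact h1.2.trans ((le_coe_toNNReal _).trans (by exact_mod_cast le_max_left _ _))
      · rw [norm_eq_abs, abs_of_nonneg h2.1]
        exact h2.2.trans ((le_coe_toNNReal _).trans (by exact_mod_cast le_max_right _ _))
  obtain ⟨R, hR0, hR⟩ := hPL.exists_eq_forall_mem_Icc_hasDerivWithinAt₀
  have hmem : ∀ t ∈ Icc (0 : ℝ) 1, R t ∈ quadrant := by
    intro t ht
    have h1 := monotoneOn_Icc_of_hasDerivWithinAt (fun s hs => (hR s hs).fst)
      (fun s _ => (h.mem_box s _).1.1) (left_mem_Icc.2 zero_le_one) ht ht.1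
    have h2 := monotoneOn_Icc_of_hasDerivWithinAt (fun s hs => (hR s hs).snd)
      (fun s _ => (h.mem_box s _).2.1) (left_mem_Icc.2 zero_le_one) ht ht.1
    have hR0' : R 0 = eps := hR0
    simp only [hR0'] at h1 h2
    exact ⟨heps.1.trans h1, heps.2.trans h2⟩
  refine ⟨R, hR0, hmem, fun t ht => ?_⟩
  have := hR t ht
  rwa [quadrantProj_eq_self (hmem t ht)] at this

theorem dist_le (h : QuadrantField pu pv G DG K) {R S : ℝ → ℝ × ℝ} (hR : IsSolution G R)
    (hS : IsSolution G S) {t : ℝ} (ht : t ∈ Icc (0 : ℝ) 1) :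
    dist (R t) (S t) ≤ dist (R 0) (S 0) * exp K := by
  have := dist_le_of_trajectories_ODE_of_mem (v := G) (s := fun _ => quadrant) (K := K)
    (fun s _ => h.lipschitzOnWith s) hR.continuousOn
    (fun s hs => (hR.2 s (Ico_subset_Icc_self hs)).Ici_of_Icc hs)
    (fun s hs => hR.1 s (Ico_subset_Icc_self hs)) hS.continuousOn
    (fun s hs => (hS.2 s (Ico_subset_Icc_self hs)).Ici_of_Icc hs)
    (fun s hs => hS.1 s (Ico_subset_Icc_self hs)) le_rfl t ht
  refine this.trans ?_
  gcongr
  nlinarith [ht.2, K.2]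

theorem dist_zero_le (h : QuadrantField pu pv G DG K) {R S : ℝ → ℝ × ℝ} (hR : IsSolution G R)
    (hS : IsSolution G S) {t : ℝ} (ht : t ∈ Icc (0 : ℝ) 1) :
    dist (R 0) (S 0) ≤ dist (R t) (S t) * exp K := by
  have hmaps : MapsTo (fun s => t - s) (Icc 0 t) (Icc 0 1) := fun s hs =>
    ⟨by linarith [hs.2], by linarith [hs.1, ht.2]⟩
  have hrev : ∀ {R : ℝ → ℝ × ℝ}, IsSolution G R → ∀ s ∈ Icc 0 t,
      HasDerivWithinAt (fun s => R (t - s)) (-G (t - s) (R (t - s))) (Icc 0 t) s := by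
    intro R hR s hs
    have h1 : HasDerivWithinAt (fun s : ℝ => t - s) (-1) (Icc 0 t) s := by
      simpa using (hasDerivWithinAt_id s (Icc 0 t)).const_sub t
    have h2 := (hR.2 (t - s) (hmaps hs)).scomp s h1 hmaps
    rw [neg_one_smul] at h2
    exact h2
  have := dist_le_of_trajectories_ODE_of_mem (v := fun s x => -G (t - s) x)
    (s := fun _ => quadrant) (K := K) (a := 0) (b := t) (f := fun s => R (t - s))
    (g := fun s => S (t - s)) (δ := dist (R t) (S t))
    (fun s _ => (h.lipschitzOnWith (t - s)).neg)
    (fun s hs => (hrev hR s hs).continuousWithinAt)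
    (fun s hs => (hrev hR s (Ico_subset_Icc_self hs)).Ici_of_Icc hs)
    (fun s hs => hR.1 _ (hmaps (Ico_subset_Icc_self hs)))
    (fun s hs => (hrev hS s hs).continuousWithinAt)
    (fun s hs => (hrev hS s (Ico_subset_Icc_self hs)).Ici_of_Icc hs)
    (fun s hs => hS.1 _ (hmaps (Ico_subset_Icc_self hs))) (by simp) t (right_mem_Icc.2 ht.1)
  simp only [sub_self, sub_zero] at this
  refine this.trans ?_
  gcongr
  nlinarith [ht.2, K.2]

/-- The derivative of the field is continuous in space, uniformly along a solution. -/
theorem exists_forall_norm_sub_lt (h : QuadrantField pu pv G DG K) {R : ℝ → ℝ × ℝ}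
    (hR : IsSolution G R) {η : ℝ} (hη : 0 < η) :
    ∃ δ > 0, ∀ t ∈ Icc (0 : ℝ) 1, ∀ y, dist y (R t) < δ → ‖DG t y - DG t (R t)‖ < η := by
  have hK : IsCompact ((fun t => (t, R t)) '' Icc (0 : ℝ) 1) :=
    isCompact_Icc.image_of_continuousOn (continuousOn_id.prodMk hR.continuousOn)
  have hu := hK.uniformContinuousAt_of_continuousAt (Function.uncurry DG)
    (fun a _ => h.continuous_deriv.continuousAt) (Metric.dist_mem_uniformity hη)
  obtain ⟨δ, hδ, hδ'⟩ := Metric.mem_uniformity_dist.1 hu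
  refine ⟨δ, hδ, fun t ht y hy => ?_⟩
  have := @hδ' (t, R t) (t, y) (by
    rw [Prod.dist_eq, dist_self, dist_comm]
    exact max_lt hδ hy)
    ⟨t, ht, rfl⟩
  rw [← dist_eq_norm, dist_comm]
  exact this

/-- `p` solves on `[0,1]` the linearization of `R' = G(t, R)` along `R`. -/
def IsLinearized (DG : ℝ → ℝ × ℝ → (ℝ × ℝ) →L[ℝ] (ℝ × ℝ)) (R p : ℝ → ℝ × ℝ) : Prop :=
  ∀ t ∈ Icc (0 : ℝ) 1, HasDerivWithinAt p (DG t (R t) (p t)) (Icc 0 1) t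

theorem exists_isLinearized (h : QuadrantField pu pv G DG K) {R : ℝ → ℝ × ℝ}
    (hR : IsSolution G R) (x₀ : ℝ × ℝ) :
    ∃ p : ℝ → ℝ × ℝ, p 0 = x₀ ∧ IsLinearized DG R p ∧
      ∀ t ∈ Icc (0 : ℝ) 1, ‖p t‖ ≤ ‖x₀‖ * exp K :=
  exists_linear_ode_solution (A := fun t => DG t (R t))
    (h.continuous_deriv.comp_continuousOn (continuousOn_id.prodMk hR.continuousOn))
    (fun t => h.norm_deriv_le t _) x₀

/-- Grönwall bound for an inhomogeneous linear equation with zero initial value. -/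
theorem norm_le_of_linear_error {w w' : ℝ → ℝ × ℝ} {c : ℝ} (h0 : w 0 = 0) (hc : 0 ≤ c)
    (hw : ∀ t ∈ Icc (0 : ℝ) 1, HasDerivWithinAt w (w' t) (Icc 0 1) t)
    (hb : ∀ t ∈ Icc (0 : ℝ) 1, ‖w' t‖ ≤ K * ‖w t‖ + c) {t : ℝ} (ht : t ∈ Icc (0 : ℝ) 1) :
    ‖w t‖ ≤ c * exp (K + 1) := by
  have h1 := norm_le_gronwallBound_of_norm_deriv_right_le (f := w) (K := K + 1) (ε := c) (δ := 0)
    (fun t ht => (hw t ht).continuousWithinAt)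
    (fun t ht => (hw t (Ico_subset_Icc_self ht)).Ici_of_Icc ht) (by simp [h0])
    (fun t ht => (hb t (Ico_subset_Icc_self ht)).trans (by nlinarith [norm_nonneg (w t)])) t ht
  have hK1 : (1 : ℝ) ≤ K + 1 := by linarith [K.2]
  rw [gronwallBound_of_K_ne_0 (by linarith)] at h1
  simp only [zero_mul, zero_add, sub_zero] at h1
  have h2 : exp ((K + 1) * t) ≤ exp (K + 1) := exp_le_exp.2 (by nlinarith [ht.2])
  have h3 : c / (K + 1) ≤ c := div_le_self hc hK1
  have h4 : 0 ≤ exp ((K + 1) * t) - 1 := by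
    have := add_one_le_exp ((K + 1) * t)
    nlinarith [ht.1]
  calc ‖w t‖ ≤ c / (K + 1) * (exp ((K + 1) * t) - 1) := h1
    _ ≤ c * (exp ((K + 1) * t) - 1) := by gcongr
    _ ≤ c * exp (K + 1) := by gcongr; linarith

theorem norm_sub_sub_le (h : QuadrantField pu pv G DG K) {R : ℝ → ℝ × ℝ} (hR : IsSolution G R)
    {η : ℝ} (hη : 0 < η) :
    ∃ δ > 0, ∀ S : ℝ → ℝ × ℝ, IsSolution G S → dist (S 0) (R 0) < δ →
      ∀ j : ℝ → ℝ × ℝ, IsLinearized DG R j → j 0 = S 0 - R 0 →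
      ∀ t ∈ Icc (0 : ℝ) 1, ‖S t - R t - j t‖ ≤ η * ‖S 0 - R 0‖ := by
  set C := exp K * exp (K + 1)
  have hC : 0 < C := by positivity
  obtain ⟨δ, hδ, hδ'⟩ := h.exists_forall_norm_sub_lt hR (div_pos hη hC)
  refine ⟨δ / exp K, by positivity, fun S hS hSR j hj hj0 t ht => ?_⟩
  have hdist : ∀ s ∈ Icc (0 : ℝ) 1, ‖S s - R s‖ ≤ ‖S 0 - R 0‖ * exp K := fun s hs => by
    simpa only [dist_eq_norm] using h.dist_le hS hR hs
  have key := norm_le_of_linear_error (K := K) (w := fun t => S t - R t - j t)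
    (w' := fun t => G t (S t) - G t (R t) - DG t (R t) (j t))
    (c := η / C * (‖S 0 - R 0‖ * exp K)) (by simp [hj0]) (by positivity)
    (fun s hs => ((hS.2 s hs).sub (hR.2 s hs)).sub (hj s hs)) (fun s hs => ?_) ht
  · refine key.trans (le_of_eq ?_)
    simp only [C]
    field_simp
  · have hsub : segment ℝ (R s) (S s) ⊆ quadrant :=
      convex_quadrant.segment_subset (hR.1 s hs) (hS.1 s hs)
    have h1 := (convex_segment (R s) (S s)).norm_image_sub_le_of_norm_hasFDerivWithin_le'
      (f := G s) (f' := DG s) (φ := DG s (R s)) (C := η / C)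
      (fun y hy => (h.hasFDerivWithinAt s y (hsub hy)).mono hsub)
      (fun y hy => by
        refine (hδ' s hs y ?_).le
        obtain ⟨θ, hθ, rfl⟩ := segment_eq_image' ℝ (R s) (S s) ▸ hy
        rw [dist_eq_norm, add_sub_cancel_left, norm_smul, norm_eq_abs, abs_of_nonneg hθ.1]
        have h2 := hdist s hs
        rw [dist_eq_norm, lt_div_iff₀ (exp_pos _)] at hSR
        nlinarith [norm_nonneg (S s - R s), hθ.2])
      (left_mem_segment ℝ _ _) (right_mem_segment ℝ _ _)
    have h2 : G s (S s) - G s (R s) - DG s (R s) (j s) =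
        DG s (R s) (S s - R s - j s) + (G s (S s) - G s (R s) - DG s (R s) (S s - R s)) := by
      rw [map_sub]
      abel
    rw [h2]
    refine (norm_add_le _ _).trans (add_le_add ?_ (h1.trans ?_))
    · exact ((DG s (R s)).le_opNorm _).trans (by gcongr; exact h.norm_deriv_le _ _)
    · gcongr
      exact hdist s hs

theorem norm_linearized_sub_le (h : QuadrantField pu pv G DG K) {R : ℝ → ℝ × ℝ}
    (hR : IsSolution G R) {p : ℝ → ℝ × ℝ} (hp : IsLinearized DG R p) {η : ℝ} (hη : 0 < η) :
    ∃ δ > 0, ∀ S : ℝ → ℝ × ℝ, IsSolution G S → dist (S 0) (R 0) < δ →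
      ∀ q : ℝ → ℝ × ℝ, IsLinearized DG S q → q 0 = p 0 →
      ∀ t ∈ Icc (0 : ℝ) 1, dist (q t) (p t) ≤ η := by
  have hpc : ContinuousOn p (Icc 0 1) := fun t ht => (hp t ht).continuousWithinAt
  obtain ⟨B, hB⟩ := isCompact_Icc.exists_bound_of_continuousOn hpc
  set C := (|B| + 1) * exp (K + 1)
  have hC : 0 < C := by positivity
  obtain ⟨δ, hδ, hδ'⟩ := h.exists_forall_norm_sub_lt hR (div_pos hη hC)
  refine ⟨δ / exp K, by positivity, fun S hS hSR q hq hq0 t ht => ?_⟩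
  have key := norm_le_of_linear_error (K := K) (w := fun t => q t - p t)
    (w' := fun t => DG t (S t) (q t) - DG t (R t) (p t))
    (c := η / C * (|B| + 1)) (by simp [hq0]) (by positivity)
    (fun s hs => (hq s hs).sub (hp s hs)) (fun s hs => ?_) ht
  · rw [dist_eq_norm]
    refine key.trans (le_of_eq ?_)
    simp only [C]
    field_simp
  · have h2 : DG s (S s) (q s) - DG s (R s) (p s) =
        DG s (S s) (q s - p s) + (DG s (S s) - DG s (R s)) (p s) := by
      rw [map_sub, sub_apply]
      abel
    rw [h2]
    refine (norm_add_le _ _).trans (add_le_add ?_ ?_)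
    · exact ((DG s (S s)).le_opNorm _).trans (by gcongr; exact h.norm_deriv_le _ _)
    · refine ((DG s (S s) - DG s (R s)).le_opNorm _).trans ?_
      gcongr
      · refine (hδ' s hs _ ((h.dist_le hS hR hs).trans_lt ?_)).le
        rwa [lt_div_iff₀ (exp_pos _)] at hSR
      · exact ((hB s hs).trans (le_abs_self B)).trans (by linarith)

theorem one_le_det (h : QuadrantField pu pv G DG K) {R p q : ℝ → ℝ × ℝ}
    (hp : IsLinearized DG R p) (hq : IsLinearized DG R q) (hp0 : p 0 = (1, 0)) (hq0 : q 0 = (0, 1))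
    {t : ℝ} (ht : t ∈ Icc (0 : ℝ) 1) :
    1 ≤ LinearMap.det ((ofColumns (p t) (q t) : (ℝ × ℝ) →L[ℝ] (ℝ × ℝ)) :
      (ℝ × ℝ) →ₗ[ℝ] (ℝ × ℝ)) := by
  rw [det_clm_prod]
  simp only [ofColumns_apply, one_smul, zero_smul, add_zero, zero_add]
  refine one_le_of_hasDerivWithinAt_mul (d := fun t => (p t).1 * (q t).2 - (q t).1 * (p t).2)
    (τ := fun t => (DG t (R t) (1, 0)).1 + (DG t (R t) (0, 1)).2) (by simp [hp0, hq0])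
    (fun s hs => ?_) (fun s _ => h.trace_nonneg s _) ht
  have hp1 : HasDerivWithinAt (fun s => (p s).1) (DG s (R s) (p s)).1 (Icc 0 1) s := (hp s hs).fst
  have hp2 : HasDerivWithinAt (fun s => (p s).2) (DG s (R s) (p s)).2 (Icc 0 1) s := (hp s hs).snd
  have hq1 : HasDerivWithinAt (fun s => (q s).1) (DG s (R s) (q s)).1 (Icc 0 1) s := (hq s hs).fst
  have hq2 : HasDerivWithinAt (fun s => (q s).2) (DG s (R s) (q s)).2 (Icc 0 1) s := (hq s hs).snd
  refine ((hp1.mul hq2).sub (hq1.mul hp2)).congr_deriv ?_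
  rw [clm_prod_apply _ (p s), clm_prod_apply _ (q s)]
  simp only [Prod.fst_add, Prod.snd_add, Prod.smul_fst, Prod.smul_snd, smul_eq_mul]
  ring

theorem odeConclusion (h : QuadrantField pu pv G DG K) : ODEConclusion pu pv G := by
  choose! Rsol hR0 hR using fun (eps : ℝ × ℝ) (heps : eps ∈ quadrant) => h.exists_isSolution heps
  have hlin : ∀ x₀ : ℝ × ℝ, ∀ eps ∈ quadrant, ∃ p : ℝ → ℝ × ℝ, p 0 = x₀ ∧
      IsLinearized DG (Rsol eps) p := fun x₀ eps heps =>
    let ⟨p, hp, hp', _⟩ := h.exists_isLinearized (hR eps heps) x₀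
    ⟨p, hp, hp'⟩
  choose! J hJ0 hJ using hlin
  have hJcont : ∀ x₀, ∀ t ∈ Icc (0 : ℝ) 1, ContinuousOn (fun eps => J x₀ eps t) quadrant := by
    intro x₀ t ht
    refine Metric.continuousOn_iff.2 fun eps heps η hη => ?_
    obtain ⟨δ, hδ, hδ'⟩ := h.norm_linearized_sub_le (hR eps heps) (hJ x₀ eps heps) (half_pos hη)
    refine ⟨δ, hδ, fun eps' heps' hd => ?_⟩
    refine (hδ' (Rsol eps') (hR eps' heps') (by rwa [hR0 eps heps, hR0 eps' heps'])
      (J x₀ eps') (hJ x₀ eps' heps') (by rw [hJ0 x₀ eps heps, hJ0 x₀ eps' heps']) t ht).trans_lt ?_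
    linarith
  refine ⟨Rsol, fun eps heps => ⟨hR0 eps heps, (hR eps heps).1, (hR eps heps).2, ?_,
    fun t _ => h.mem_box t _⟩, fun eps heps g hg0 hg hg' t ht => ?_, fun t ht => ?_⟩
  · exact h.continuous.comp_continuousOn (continuousOn_id.prodMk (hR eps heps).continuousOn)
  · have := h.dist_le (R := g) ⟨hg, hg'⟩ (hR eps heps) ht
    rw [hg0, hR0 eps heps, dist_self, zero_mul] at this
    exact dist_le_zero.1 this
  set D : ℝ × ℝ → (ℝ × ℝ) →L[ℝ] (ℝ × ℝ) :=
    fun eps => ofColumns (J (1, 0) eps t) (J (0, 1) eps t) with hD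
  have hdist : ∀ eps ∈ quadrant, ∀ eps' ∈ quadrant,
      dist eps eps' ≤ dist (Rsol eps t) (Rsol eps' t) * exp K := by
    intro eps heps eps' heps'
    have := h.dist_zero_le (hR eps heps) (hR eps' heps') ht
    rwa [hR0 eps heps, hR0 eps' heps'] at this
  have hinj : InjOn (fun eps => Rsol eps t) quadrant := by
    intro eps heps eps' heps' he
    have := hdist eps heps eps' heps'
    simp only at he
    rw [he, dist_self, zero_mul] at this
    exact dist_le_zero.1 this
  have hDder : ∀ eps ∈ quadrant,
      HasFDerivWithinAt (fun eps' => Rsol eps' t) (D eps) quadrant eps := by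
    intro eps heps
    rw [hasFDerivWithinAt_iff_isLittleO, Asymptotics.isLittleO_iff]
    intro η hη
    obtain ⟨δ, hδ, hδ'⟩ := h.norm_sub_sub_le (hR eps heps) hη
    filter_upwards [self_mem_nhdsWithin, mem_nhdsWithin_of_mem_nhds (Metric.ball_mem_nhds eps hδ)]
      with eps' heps' hd
    have := hδ' (Rsol eps') (hR eps' heps') (by rwa [hR0 eps heps, hR0 eps' heps'])
      (fun t => (eps' - eps).1 • J (1, 0) eps t + (eps' - eps).2 • J (0, 1) eps t)
      (fun s hs => by
        rw [map_add, map_smul, map_smul]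
        exact ((hJ (1, 0) eps heps s hs).const_smul (eps' - eps).1).add
          ((hJ (0, 1) eps heps s hs).const_smul (eps' - eps).2))
      (by
        rw [hJ0 _ eps heps, hJ0 _ eps heps, hR0 eps heps, hR0 eps' heps']
        ext <;> simp) t ht
    rwa [hR0 eps heps, hR0 eps' heps'] at this
  have hDc : ContinuousOn D quadrant :=
    Continuous.ofColumns.comp_continuousOn ((hJcont (1, 0) t ht).prodMk (hJcont (0, 1) t ht))
  have hdet : ∀ eps ∈ quadrant, 1 ≤ LinearMap.det ((D eps) : (ℝ × ℝ) →ₗ[ℝ] (ℝ × ℝ)) :=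
    fun eps heps => h.one_le_det (hJ _ eps heps) (hJ _ eps heps) (hJ0 _ eps heps)
      (hJ0 _ eps heps) ht
  have hDe : ∀ eps ∈ quadrant, ∃ e : (ℝ × ℝ) ≃L[ℝ] (ℝ × ℝ),
      (e : (ℝ × ℝ) →L[ℝ] (ℝ × ℝ)) = D eps := fun eps heps =>
    ⟨(D eps).toContinuousLinearEquivOfDetNeZero
      (by
        have := hdet eps heps
        exact ne_of_gt (by linarith)), by ext <;> rfl⟩
  refine ⟨hinj, D, hDder, hDc, hdet, Function.invFunOn (fun eps => Rsol eps t) quadrant,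
    fun y => (D (Function.invFunOn (fun eps => Rsol eps t) quadrant y)).inverse,
    fun eps heps => hinj.leftInvOn_invFunOn heps, ?_, ?_⟩
  all_goals
    set ψ := Function.invFunOn (fun eps => Rsol eps t) quadrant with hψ
    have hψl : ∀ eps ∈ quadrant, ψ (Rsol eps t) = eps := fun eps heps =>
      hinj.leftInvOn_invFunOn heps
    have hψm : MapsTo ψ ((fun eps => Rsol eps t) '' quadrant) quadrant := by
      rintro _ ⟨eps, heps, rfl⟩
      simpa only [hψl eps heps] using heps
    have hψc : ContinuousOn ψ ((fun eps => Rsol eps t) '' quadrant) := by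
      refine LipschitzOnWith.continuousOn (K := ⟨exp K, (exp_pos _).le⟩)
        (LipschitzOnWith.of_dist_le_mul ?_)
      rintro _ ⟨eps, heps, rfl⟩ _ ⟨eps', heps', rfl⟩
      simp only [hψl eps heps, hψl eps' heps']
      rw [mul_comm]
      exact hdist eps heps eps' heps'
  · rintro _ ⟨eps, heps, rfl⟩
    obtain ⟨e, he⟩ := hDe eps heps
    simp only [hψl eps heps]
    rw [← he, ContinuousLinearMap.inverse_equiv]
    refine HasFDerivWithinAt.of_local_left_inverse (f := fun eps => Rsol eps t) (t := quadrant)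
      ?_ ?_ ⟨eps, heps, rfl⟩ ?_
    · exact tendsto_nhdsWithin_iff.2 ⟨hψc _ ⟨eps, heps, rfl⟩,
        eventually_mem_nhdsWithin.mono fun y hy => hψm hy⟩
    · rw [hψl eps heps, he]
      exact hDder eps heps
    · filter_upwards [self_mem_nhdsWithin]
      rintro _ ⟨eps', heps', rfl⟩
      simp only [hψl eps' heps']
  · intro y hy
    obtain ⟨e, he⟩ := hDe (ψ y) (hψm hy)
    have h1 : ContinuousAt ContinuousLinearMap.inverse (D (ψ y)) := by
      rw [← he]
      exact (contDiffAt_map_inverse (n := 0) e).continuousAt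
    exact ContinuousAt.comp_continuousWithinAt (f := fun y => D (ψ y)) h1
      ((hDc.comp hψc hψm) y hy)

end QuadrantField

theorem ODEConclusion.congr {pu pv : ℝ} {G G' : ℝ → ℝ × ℝ → ℝ × ℝ} (h : ODEConclusion pu pv G)
    (hG : ∀ t ∈ Icc (0 : ℝ) 1, ∀ R ∈ quadrant, G' t R = G t R) : ODEConclusion pu pv G' := by
  obtain ⟨R, h1, h2, h3⟩ := h
  refine ⟨R, fun eps heps => ?_, fun eps heps g hg0 hg hg' => ?_, h3⟩
  · obtain ⟨ha, hb, hc, hd, he⟩ := h1 eps heps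
    have hGR : ∀ t ∈ Icc (0 : ℝ) 1, G' t (R eps t) = G t (R eps t) := fun t ht =>
      hG t ht _ (hb t ht)
    exact ⟨ha, hb, fun t ht => hGR t ht ▸ hc t ht, hd.congr hGR, fun t ht => hGR t ht ▸ he t ht⟩
  · exact h2 eps heps g hg0 hg fun t ht => hG t ht _ (hg t ht) ▸ hg' t ht

open ProbabilityTheory in
/-- The law of independent standard Gaussian variables indexed by `κ`. -/
def gaussianPi (κ : Type*) [Fintype κ] : Measure (κ → ℝ) :=
  Measure.pi fun _ : κ => gaussianReal 0 1

section Gaussian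

open ProbabilityTheory

variable {κ : Type*} [Fintype κ]

instance : IsProbabilityMeasure (gaussianPi κ) := by
  unfold gaussianPi
  infer_instance

theorem integrable_exp_sum_abs (M : ℝ) :
    Integrable (fun y : κ → ℝ => exp (M * ∑ k, |y k|)) (gaussianPi κ) := by
  have h : ∀ _ : κ, Integrable (fun w : ℝ => exp (M * |w|)) (gaussianReal 0 1) := fun _ =>
    integrable_exp_mul_abs (X := id) (integrable_exp_mul_gaussianReal M)
      (integrable_exp_mul_gaussianReal (-M))
  simpa only [gaussianPi, Finset.mul_sum, exp_sum] using Integrable.fintype_prod h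

theorem gaussianReal_map_add_eq_withDensity (a : ℝ) :
    (gaussianReal 0 1).map (· + a) =
      (gaussianReal 0 1).withDensity fun y => ENNReal.ofReal (exp (a * y - a ^ 2 / 2)) := by
  rw [gaussianReal_map_add_const, gaussianReal_of_var_ne_zero _ one_ne_zero,
    gaussianReal_of_var_ne_zero _ one_ne_zero,
    ← withDensity_mul _ (measurable_gaussianPDF _ _) (by fun_prop)]
  congr 1
  ext y
  simp only [gaussianPDF, gaussianPDFReal, Pi.mul_apply]
  rw [← ENNReal.ofReal_mul (by positivity), mul_assoc _ (rexp _), ← exp_add]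
  congr 3
  simp only [NNReal.coe_one]
  ring

theorem integrable_exp_linear (a : ℝ) :
    Integrable (fun y : ℝ => exp (a * y - a ^ 2 / 2)) (gaussianReal 0 1) := by
  simpa only [exp_sub] using (integrable_exp_mul_gaussianReal a).div_const (exp (a ^ 2 / 2))

/-- **Cameron–Martin formula** for the standard Gaussian measure on `ℝ^κ`. -/
theorem gaussianPi_map_add (a : κ → ℝ) :
    (gaussianPi κ).map (· + a) = (gaussianPi κ).withDensity fun y =>
      ENNReal.ofReal (exp (∑ k, (a k * y k - a k ^ 2 / 2))) := by
  have h1 : (gaussianPi κ).map (· + a) =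
      Measure.pi fun k => (gaussianReal 0 1).map (· + a k) := by
    rw [← Measure.pi_map_pi fun k => (measurable_add_const (a k)).aemeasurable]
    rfl
  rw [h1]
  refine (Measure.pi_eq fun s hs => ?_)
  have hint : ∀ k, Integrable (fun y : ℝ => exp (a k * y - a k ^ 2 / 2))
      ((gaussianReal 0 1).restrict (s k)) := fun k => (integrable_exp_linear (a k)).restrict
  have hprod := Integrable.fintype_prod hint
  rw [withDensity_apply _ (MeasurableSet.univ_pi hs), gaussianPi, Measure.restrict_pi_pi]
  simp only [exp_sum]
  rw [← ofReal_integral_eq_lintegral_ofReal hprod (ae_of_all _ fun y => by positivity),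
    integral_fintype_prod_eq_prod (fun k (y : ℝ) => exp (a k * y - a k ^ 2 / 2)),
    ENNReal.ofReal_prod_of_nonneg fun k _ => integral_nonneg fun y => (exp_pos _).le]
  refine Finset.prod_congr rfl fun k _ => ?_
  rw [gaussianReal_map_add_eq_withDensity, withDensity_apply _ (hs k),
    ofReal_integral_eq_lintegral_ofReal (hint k) (ae_of_all _ fun y => (exp_pos _).le)]

theorem integral_gaussianPi_add (a : κ → ℝ) (F : (κ → ℝ) → ℝ) :
    ∫ z, F (z + a) ∂gaussianPi κ =
      ∫ y, F y * exp (∑ k, (a k * y k - a k ^ 2 / 2)) ∂gaussianPi κ := by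
  have h := (MeasurableEquiv.addRight a).measurableEmbedding.integral_map
    (μ := gaussianPi κ) F
  simp only [MeasurableEquiv.coe_addRight] at h
  rw [← h, gaussianPi_map_add, integral_withDensity_eq_integral_toReal_smul (by fun_prop)
    (ae_of_all _ fun _ => ENNReal.ofReal_lt_top)]
  simp only [ENNReal.toReal_ofReal (exp_pos _).le, smul_eq_mul, mul_comm]

theorem integrable_of_abs_le_exp {F : (κ → ℝ) → ℝ} {C M : ℝ} (hF : Continuous F)
    (hb : ∀ y, |F y| ≤ C * exp (M * ∑ k, |y k|)) : Integrable F (gaussianPi κ) :=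
  ((integrable_exp_sum_abs M).const_mul C).mono' hF.aestronglyMeasurable (ae_of_all _ hb)

theorem hasDerivAt_integral_add_single [DecidableEq κ] {k : κ} {F F' : (κ → ℝ) → ℝ} {C M : ℝ}
    (hC : 0 ≤ C) (hM : 0 ≤ M) (hF : Continuous F) (hF' : Continuous F')
    (hb : ∀ y, |F y| ≤ C * exp (M * ∑ k, |y k|)) (hb' : ∀ y, |F' y| ≤ C * exp (M * ∑ k, |y k|))
    (hd : ∀ (y : κ → ℝ) (a : ℝ),
      HasDerivAt (fun a => F (y + Pi.single k a)) (F' (y + Pi.single k a)) a) :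
    HasDerivAt (fun a => ∫ y, F (y + Pi.single k a) ∂gaussianPi κ)
      (∫ y, F' y ∂gaussianPi κ) 0 := by
  have h := (hasDerivAt_integral_of_dominated_loc_of_deriv_le (μ := gaussianPi κ)
    (F := fun a y => F (y + Pi.single k a)) (F' := fun a y => F' (y + Pi.single k a))
    (x₀ := (0 : ℝ)) (bound := fun y => C * exp M * exp (M * ∑ k, |y k|))
    (Metric.ball_mem_nhds 0 one_pos)
    (.of_forall fun a => (by fun_prop : Continuous _).aestronglyMeasurable)
    (by simpa using integrable_of_abs_le_exp hF hb)
    (by fun_prop : Continuous _).aestronglyMeasurable ?_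
    ((integrable_exp_sum_abs M).const_mul _) (ae_of_all _ fun y a _ => hd y a)).2
  · simpa using h
  · refine ae_of_all _ fun y a ha => (hb' _).trans ?_
    rw [mul_assoc, ← exp_add]
    rw [mem_ball_zero_iff, norm_eq_abs] at ha
    gcongr
    have h1 : ∑ i, |(y + Pi.single k a : κ → ℝ) i| ≤ ∑ i, |y i| + |a| := by
      calc ∑ i, |(y + Pi.single k a : κ → ℝ) i|
          ≤ ∑ i, (|y i| + |Pi.single (M := fun _ => ℝ) k a i|) :=
            Finset.sum_le_sum fun i _ => abs_add_le _ _
        _ = ∑ i, |y i| + |a| := by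
            rw [Finset.sum_add_distrib, add_right_inj,
              Finset.sum_eq_single k (fun i _ hi => by simp [hi]) (by simp), Pi.single_eq_same]
    nlinarith

/-- **Gaussian integration by parts** in the `k`-th coordinate. -/
theorem integral_coord_mul_gaussianPi [DecidableEq κ] {k : κ} {F F' : (κ → ℝ) → ℝ} {C M : ℝ}
    (hC : 0 ≤ C) (hM : 0 ≤ M) (hF : Continuous F) (hF' : Continuous F')
    (hb : ∀ y, |F y| ≤ C * exp (M * ∑ k, |y k|)) (hb' : ∀ y, |F' y| ≤ C * exp (M * ∑ k, |y k|))
    (hd : ∀ (y : κ → ℝ) (a : ℝ),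
      HasDerivAt (fun a => F (y + Pi.single k a)) (F' (y + Pi.single k a)) a) :
    ∫ y, y k * F y ∂gaussianPi κ = ∫ y, F' y ∂gaussianPi κ := by
  have h1 := hasDerivAt_integral_add_single hC hM hF hF' hb hb' hd
  have h2 : ∀ (a : ℝ) (y : κ → ℝ),
      ∑ i, (Pi.single (M := fun _ => ℝ) k a i * y i - Pi.single (M := fun _ => ℝ) k a i ^ 2 / 2) =
        a * y k - a ^ 2 / 2 := fun a y => by
    rw [Finset.sum_eq_single k (fun i _ hi => by simp [hi]) (by simp), Pi.single_eq_same]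
  simp only [integral_gaussianPi_add, h2] at h1
  refine (HasDerivAt.unique h1 ?_).symm
  have h := (hasDerivAt_integral_of_dominated_loc_of_deriv_le (μ := gaussianPi κ)
    (F := fun a y => F y * exp (a * y k - a ^ 2 / 2))
    (F' := fun a y => F y * (exp (a * y k - a ^ 2 / 2) * (y k - a)))
    (x₀ := (0 : ℝ)) (bound := fun y => C * exp ((M + 2) * ∑ k, |y k|))
    (Metric.ball_mem_nhds 0 one_pos)
    (.of_forall fun a => (by fun_prop : Continuous _).aestronglyMeasurable)
    (by simpa using integrable_of_abs_le_exp hF hb)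
    (by fun_prop : Continuous _).aestronglyMeasurable ?_
    ((integrable_exp_sum_abs _).const_mul _) ?_).2
  · simpa [mul_comm] using h
  · refine ae_of_all _ fun y a ha => ?_
    rw [mem_ball_zero_iff, norm_eq_abs] at ha
    have hk : |y k| ≤ ∑ k, |y k| :=
      Finset.single_le_sum (f := fun k => |y k|) (fun _ _ => abs_nonneg _) (Finset.mem_univ k)
    have h3 : |y k - a| ≤ exp (∑ k, |y k|) := by
      have := add_one_le_exp (∑ k, |y k|)
      have := abs_sub (y k) a
      linarith
    have h4 : a * y k - a ^ 2 / 2 ≤ ∑ k, |y k| := by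
      have h5 : a * y k ≤ |a| * |y k| := (le_abs_self _).trans (abs_mul _ _).le
      nlinarith [abs_nonneg (y k), sq_nonneg a]
    rw [norm_mul, norm_mul, norm_eq_abs, norm_eq_abs, norm_eq_abs, abs_exp]
    calc |F y| * (exp (a * y k - a ^ 2 / 2) * |y k - a|)
        ≤ C * exp (M * ∑ k, |y k|) * (exp (∑ k, |y k|) * exp (∑ k, |y k|)) := by
          gcongr
          exact hb y
      _ = C * exp ((M + 2) * ∑ k, |y k|) := by
          rw [← exp_add, mul_assoc, ← exp_add]
          ring_nf
  · refine ae_of_all _ fun y a _ => ?_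
    have := ((((hasDerivAt_id a).mul_const (y k)).sub
      (((hasDerivAt_id a).pow 2).div_const 2)).exp).const_mul (F y)
    refine this.congr_deriv ?_
    simp

end Gaussian

section Tilt

variable {κ Ω : Type*} [MeasurableSpace Ω] {P : Measure Ω} {x : Ω → κ → ℝ}
  {f g : Ω → ℝ} {B C : ℝ}

theorem ae_abs_mul_coord_le (hB : ∀ᵐ ω ∂P, ∀ k, |x ω k| ≤ B) (hC : ∀ᵐ ω ∂P, |g ω| ≤ C) (k : κ) :
    ∀ᵐ ω ∂P, |g ω * x ω k| ≤ C * B := by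
  filter_upwards [hB, hC] with ω hω hω'
  rw [abs_mul]
  exact mul_le_mul hω' (hω k) (abs_nonneg _) ((abs_nonneg _).trans hω')

theorem ae_abs_mul_coord_sq_le (hB : ∀ᵐ ω ∂P, ∀ k, |x ω k| ≤ B) (hC : ∀ᵐ ω ∂P, |g ω| ≤ C)
    (k : κ) : ∀ᵐ ω ∂P, |g ω * x ω k ^ 2| ≤ C * B ^ 2 := by
  filter_upwards [hB, hC] with ω hω hω'
  rw [abs_mul, abs_pow]
  exact mul_le_mul hω' (pow_le_pow_left₀ (abs_nonneg _) (hω k) 2) (by positivity)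
    ((abs_nonneg _).trans hω')

/-- A signal `x` with values in `ℝ^κ` and an observable `f`, both bounded by `B`. -/
structure BoundedSignal (P : Measure Ω) (x : Ω → κ → ℝ) (f : Ω → ℝ) (B : ℝ) : Prop where
  one_le : 1 ≤ B
  measurable : Measurable x
  ae_coord_le : ∀ᵐ ω ∂P, ∀ k, |x ω k| ≤ B
  aestronglyMeasurable : AEStronglyMeasurable f P
  ae_le : ∀ᵐ ω ∂P, |f ω| ≤ B

/-- An observable which is bounded almost everywhere. -/
def IsBoundedBy (P : Measure Ω) (g : Ω → ℝ) (C : ℝ) : Prop :=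
  AEStronglyMeasurable g P ∧ ∀ᵐ ω ∂P, |g ω| ≤ C

namespace BoundedSignal

theorem isBoundedBy (h : BoundedSignal P x f B) : IsBoundedBy P f B :=
  ⟨h.aestronglyMeasurable, h.ae_le⟩

theorem isBoundedBy_one : IsBoundedBy P (fun _ => 1) 1 :=
  ⟨aestronglyMeasurable_const, ae_of_all _ fun _ => by simp⟩

theorem aestronglyMeasurable_coord (h : BoundedSignal P x f B) (k : κ) :
    AEStronglyMeasurable (fun ω => x ω k) P :=
  ((measurable_pi_apply k).comp h.measurable).aestronglyMeasurable

theorem isBoundedBy_mul (h : BoundedSignal P x f B) (hg : IsBoundedBy P g C) (k : κ) :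
    IsBoundedBy P (fun ω => g ω * x ω k) (C * B) :=
  ⟨hg.1.mul (h.aestronglyMeasurable_coord k), ae_abs_mul_coord_le h.ae_coord_le hg.2 k⟩

theorem isBoundedBy_mul_sq (h : BoundedSignal P x f B) (hg : IsBoundedBy P g C) (k : κ) :
    IsBoundedBy P (fun ω => g ω * x ω k ^ 2) (C * B ^ 2) :=
  ⟨hg.1.mul ((h.aestronglyMeasurable_coord k).pow 2),
    ae_abs_mul_coord_sq_le h.ae_coord_le hg.2 k⟩

theorem isBoundedBy_coord (h : BoundedSignal P x f B) (k : κ) :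
    IsBoundedBy P (fun ω => x ω k) B := by
  simpa only [one_mul] using h.isBoundedBy_mul isBoundedBy_one k

theorem isBoundedBy_coord_sq (h : BoundedSignal P x f B) (k : κ) :
    IsBoundedBy P (fun ω => x ω k ^ 2) (B ^ 2) := by
  simpa only [one_mul] using h.isBoundedBy_mul_sq isBoundedBy_one k

theorem isBoundedBy_sq (h : BoundedSignal P x f B) : IsBoundedBy P (fun ω => f ω ^ 2) (B ^ 2) :=
  ⟨h.aestronglyMeasurable.pow 2, h.ae_le.mono fun ω hω => by
    rw [abs_pow]
    exact pow_le_pow_left₀ (abs_nonneg _) hω 2⟩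

theorem four_mul_pow_nonneg (h : BoundedSignal P x f B) : 0 ≤ 4 * B ^ 4 := by
  have := h.one_le
  positivity

end BoundedSignal

variable [Fintype κ]

/-- The log-likelihood ratio of the Gaussian channel `y = s ξ + noise` with signal `ξ`. -/
def channelExponent (s y ξ : κ → ℝ) : ℝ :=
  ∑ k, (s k * ξ k * y k - s k ^ 2 * ξ k ^ 2 / 2)

/-- The integral of `g` against the unnormalized posterior of the signal `x` given `y`. -/
def tiltedIntegral (P : Measure Ω) (x : Ω → κ → ℝ) (g : Ω → ℝ) (s y : κ → ℝ) : ℝ :=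
  ∫ ω, g ω * exp (channelExponent s y (x ω)) ∂P

/-- The derivative of `channelExponent` in `(s, y)`. -/
def channelExponentDeriv (p : (κ → ℝ) × (κ → ℝ)) (ξ : κ → ℝ) :
    ((κ → ℝ) × (κ → ℝ)) →L[ℝ] ℝ :=
  ∑ k, ((p.2 k * ξ k - p.1 k * ξ k ^ 2) •
      (ContinuousLinearMap.proj k ∘L ContinuousLinearMap.fst ℝ (κ → ℝ) (κ → ℝ)) +
    (p.1 k * ξ k) • (ContinuousLinearMap.proj k ∘L ContinuousLinearMap.snd ℝ (κ → ℝ) (κ → ℝ)))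

theorem continuous_channelExponent : Continuous fun q : ((κ → ℝ) × (κ → ℝ)) × (κ → ℝ) =>
    channelExponent q.1.1 q.1.2 q.2 := by
  unfold channelExponent
  fun_prop

theorem continuous_channelExponentDeriv : Continuous fun q : ((κ → ℝ) × (κ → ℝ)) × (κ → ℝ) =>
    channelExponentDeriv q.1 q.2 := by
  unfold channelExponentDeriv
  fun_prop

theorem hasFDerivAt_channelExponent (p : (κ → ℝ) × (κ → ℝ)) (ξ : κ → ℝ) :
    HasFDerivAt (fun p : (κ → ℝ) × (κ → ℝ) => channelExponent p.1 p.2 ξ)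
      (channelExponentDeriv p ξ) p := by
  unfold channelExponent channelExponentDeriv
  refine HasFDerivAt.fun_sum fun k _ => ?_
  have h1 : HasFDerivAt (fun p : (κ → ℝ) × (κ → ℝ) => p.1 k)
      (ContinuousLinearMap.proj k ∘L ContinuousLinearMap.fst ℝ (κ → ℝ) (κ → ℝ)) p :=
    (ContinuousLinearMap.proj k ∘L ContinuousLinearMap.fst ℝ (κ → ℝ) (κ → ℝ)).hasFDerivAt
  have h2 : HasFDerivAt (fun p : (κ → ℝ) × (κ → ℝ) => p.2 k)
      (ContinuousLinearMap.proj k ∘L ContinuousLinearMap.snd ℝ (κ → ℝ) (κ → ℝ)) p :=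
    (ContinuousLinearMap.proj k ∘L ContinuousLinearMap.snd ℝ (κ → ℝ) (κ → ℝ)).hasFDerivAt
  refine (((h1.mul_const (ξ k)).mul h2).sub
    (((h1.pow 2).mul_const (ξ k ^ 2)).mul_const (1 / 2))).congr_fderiv ?_ |>.congr_of_eventuallyEq
      (.of_forall fun q => ?_)
  · ext v
    · simp
      ring
    · simp
  · simp only [Pi.sub_apply, Pi.mul_apply]
    ring

theorem channelExponent_le {S : ℝ} {s ξ : κ → ℝ}
    (hs : ∀ k, |s k| ≤ S) (hξ : ∀ k, |ξ k| ≤ B) (y : κ → ℝ) :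
    channelExponent s y ξ ≤ S * B * ∑ k, |y k| := by
  rw [channelExponent, Finset.mul_sum]
  refine Finset.sum_le_sum fun k _ => ?_
  have h2 : s k * ξ k * y k ≤ |s k| * |ξ k| * |y k| := by
    rw [← abs_mul, ← abs_mul]
    exact le_abs_self _
  have h3 : |s k| * |ξ k| * |y k| ≤ S * B * |y k| := by
    gcongr
    · exact (abs_nonneg _).trans (hs k)
    · exact hs k
    · exact hξ k
  nlinarith [mul_nonneg (sq_nonneg (s k)) (sq_nonneg (ξ k))]

variable [IsProbabilityMeasure P]

theorem exists_bound_channel (B : ℝ) (p₀ : (κ → ℝ) × (κ → ℝ)) :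
    ∃ K, ∀ p ∈ Metric.closedBall p₀ 1, ∀ ξ : κ → ℝ, (∀ k, |ξ k| ≤ B) →
      exp (channelExponent p.1 p.2 ξ) ≤ K ∧
      exp (channelExponent p.1 p.2 ξ) * ‖channelExponentDeriv p ξ‖ ≤ K := by
  have hcomp : IsCompact (Metric.closedBall p₀ 1 ×ˢ Metric.closedBall (0 : κ → ℝ) |B|) :=
    (isCompact_closedBall _ _).prod (isCompact_closedBall _ _)
  have hc : Continuous fun q : ((κ → ℝ) × (κ → ℝ)) × (κ → ℝ) =>
      exp (channelExponent q.1.1 q.1.2 q.2) := continuous_exp.comp continuous_channelExponent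
  obtain ⟨K₁, hK₁⟩ := hcomp.exists_bound_of_continuousOn hc.continuousOn
  obtain ⟨K₂, hK₂⟩ := hcomp.exists_bound_of_continuousOn
    (hc.mul continuous_channelExponentDeriv.norm).continuousOn
  refine ⟨max K₁ K₂, fun p hp ξ hξ => ?_⟩
  have hm : (p, ξ) ∈ Metric.closedBall p₀ 1 ×ˢ Metric.closedBall (0 : κ → ℝ) |B| := by
    refine ⟨hp, ?_⟩
    rw [mem_closedBall_zero_iff, pi_norm_le_iff_of_nonneg (abs_nonneg _)]
    exact fun k => (hξ k).trans (le_abs_self B)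
  exact ⟨((le_abs_self _).trans (hK₁ _ hm)).trans (le_max_left _ _),
    ((le_abs_self _).trans (hK₂ _ hm)).trans (le_max_right _ _)⟩

theorem integrable_tilted (hx : Measurable x) (hB : ∀ᵐ ω ∂P, ∀ k, |x ω k| ≤ B)
    (hg : AEStronglyMeasurable g P) (hC : ∀ᵐ ω ∂P, |g ω| ≤ C) (s y : κ → ℝ) :
    Integrable (fun ω => g ω * exp (channelExponent s y (x ω))) P := by
  obtain ⟨K, hK⟩ := exists_bound_channel B (s, y)
  have hm : Continuous (fun ξ : κ → ℝ => exp (channelExponent s y ξ)) :=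
    continuous_exp.comp (continuous_channelExponent.comp (.prodMk_right (s, y)))
  refine Integrable.of_bound (hg.mul (hm.measurable.comp hx).aestronglyMeasurable) (C * K) ?_
  filter_upwards [hB, hC] with ω hω hω'
  rw [norm_mul, norm_eq_abs, norm_eq_abs, abs_exp]
  exact mul_le_mul hω' (hK (s, y) (by simp) _ hω).1 (exp_pos _).le ((abs_nonneg _).trans hω')

theorem hasFDerivAt_tiltedIntegral (hx : Measurable x) (hB : ∀ᵐ ω ∂P, ∀ k, |x ω k| ≤ B)
    (hg : AEStronglyMeasurable g P) (hC : ∀ᵐ ω ∂P, |g ω| ≤ C) (p : (κ → ℝ) × (κ → ℝ)) :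
    HasFDerivAt (fun p : (κ → ℝ) × (κ → ℝ) => tiltedIntegral P x g p.1 p.2)
      (∑ k, ((p.2 k * tiltedIntegral P x (fun ω => g ω * x ω k) p.1 p.2 -
            p.1 k * tiltedIntegral P x (fun ω => g ω * x ω k ^ 2) p.1 p.2) •
          (ContinuousLinearMap.proj k ∘L ContinuousLinearMap.fst ℝ (κ → ℝ) (κ → ℝ)) +
        (p.1 k * tiltedIntegral P x (fun ω => g ω * x ω k) p.1 p.2) •
          (ContinuousLinearMap.proj k ∘L ContinuousLinearMap.snd ℝ (κ → ℝ) (κ → ℝ)))) p := by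
  obtain ⟨K, hK⟩ := exists_bound_channel B p
  have hxk : ∀ k, AEStronglyMeasurable (fun ω => x ω k) P := fun k =>
    ((measurable_pi_apply k).comp hx).aestronglyMeasurable
  have hm : AEStronglyMeasurable (fun ω => channelExponentDeriv p (x ω)) P :=
    ((continuous_channelExponentDeriv.comp (.prodMk_right p)).measurable.comp
      hx).aestronglyMeasurable
  have hint := fun s y => integrable_tilted hx hB hg hC s y
  have hint1 : ∀ k, Integrable (fun ω => g ω * x ω k *
      exp (channelExponent p.1 p.2 (x ω))) P := fun k =>
    integrable_tilted hx hB (hg.mul (hxk k)) (ae_abs_mul_coord_le hB hC k) _ _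
  have hint2 : ∀ k, Integrable (fun ω => g ω * x ω k ^ 2 *
      exp (channelExponent p.1 p.2 (x ω))) P := fun k =>
    integrable_tilted hx hB (hg.mul ((hxk k).pow 2)) (ae_abs_mul_coord_sq_le hB hC k) _ _
  have h := hasFDerivAt_integral_of_dominated_of_fderiv_le (μ := P) (𝕜 := ℝ) (x₀ := p)
    (F := fun p ω => g ω * exp (channelExponent p.1 p.2 (x ω)))
    (F' := fun p ω => g ω • (exp (channelExponent p.1 p.2 (x ω)) •
      channelExponentDeriv p (x ω))) (bound := fun _ => C * K)
    (Metric.closedBall_mem_nhds p one_pos) (.of_forall fun q => (hint _ _).aestronglyMeasurable)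
    (hint _ _) ?_ ?_ (integrable_const _) ?_
  · refine h.congr_fderiv ?_
    have he : ∀ ω, g ω • (exp (channelExponent p.1 p.2 (x ω)) • channelExponentDeriv p (x ω)) =
        ∑ k, ((p.2 k * (g ω * x ω k * exp (channelExponent p.1 p.2 (x ω))) -
            p.1 k * (g ω * x ω k ^ 2 * exp (channelExponent p.1 p.2 (x ω)))) •
          (ContinuousLinearMap.proj k ∘L ContinuousLinearMap.fst ℝ (κ → ℝ) (κ → ℝ)) +
        (p.1 k * (g ω * x ω k * exp (channelExponent p.1 p.2 (x ω)))) •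
          (ContinuousLinearMap.proj k ∘L ContinuousLinearMap.snd ℝ (κ → ℝ) (κ → ℝ))) := by
      intro ω
      simp only [channelExponentDeriv, Finset.smul_sum, smul_add, smul_smul]
      refine Finset.sum_congr rfl fun k _ => ?_
      congr 2 <;> ring
    simp only [he]
    have hi1 : ∀ k, Integrable (fun ω =>
        p.2 k * (g ω * x ω k * exp (channelExponent p.1 p.2 (x ω))) -
          p.1 k * (g ω * x ω k ^ 2 * exp (channelExponent p.1 p.2 (x ω)))) P := fun k =>
      ((hint1 k).const_mul (p.2 k)).sub ((hint2 k).const_mul (p.1 k))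
    have hi2 := fun k => (hint1 k).const_mul (p.1 k)
    rw [integral_finsetSum _ fun k _ => ((hi1 k).smul_const _).add ((hi2 k).smul_const _)]
    refine Finset.sum_congr rfl fun k _ => ?_
    rw [integral_add ((hi1 k).smul_const _) ((hi2 k).smul_const _), integral_smul_const,
      integral_smul_const, integral_sub ((hint1 k).const_mul _) ((hint2 k).const_mul _),
      integral_const_mul, integral_const_mul, integral_const_mul]
    simp only [tiltedIntegral]
  · exact hg.smul (((continuous_exp.comp (continuous_channelExponent.comp
      (.prodMk_right p))).measurable.comp hx).aestronglyMeasurable.smul hm)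
  · filter_upwards [hB, hC] with ω hω hω' q hq
    rw [norm_smul, norm_smul, norm_eq_abs, norm_eq_abs, abs_exp]
    exact mul_le_mul hω' (hK q hq _ hω).2 (by positivity) ((abs_nonneg _).trans hω')
  · refine ae_of_all _ fun ω q _ => ?_
    simpa only [smul_eq_mul] using
      ((hasFDerivAt_channelExponent q (x ω)).exp).const_mul (g ω)

namespace BoundedSignal

local notation "T" => tiltedIntegral P x

theorem integrable (h : BoundedSignal P x f B) (hg : IsBoundedBy P g C) (s y : κ → ℝ) :
    Integrable (fun ω => g ω * exp (channelExponent s y (x ω))) P :=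
  integrable_tilted h.measurable h.ae_coord_le hg.1 hg.2 s y

theorem continuous_tiltedIntegral (h : BoundedSignal P x f B) (hg : IsBoundedBy P g C) :
    Continuous fun p : (κ → ℝ) × (κ → ℝ) => T g p.1 p.2 :=
  continuous_iff_continuousAt.2 fun p =>
    (hasFDerivAt_tiltedIntegral h.measurable h.ae_coord_le hg.1 hg.2 p).continuousAt

theorem hasFDerivAt_left (h : BoundedSignal P x f B) (hg : IsBoundedBy P g C) (s y : κ → ℝ) :
    HasFDerivAt (fun s => T g s y)
      (∑ k, (y k * T (fun ω => g ω * x ω k) s y - s k * T (fun ω => g ω * x ω k ^ 2) s y) •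
        (ContinuousLinearMap.proj k : (κ → ℝ) →L[ℝ] ℝ)) s := by
  refine (HasFDerivAt.comp (g := fun p : (κ → ℝ) × (κ → ℝ) => T g p.1 p.2)
    (f := fun s => (s, y)) s
    (hasFDerivAt_tiltedIntegral h.measurable h.ae_coord_le hg.1 hg.2 (s, y))
    (hasFDerivAt_prodMk_left s y)).congr_fderiv ?_
  ext v
  simp

theorem hasDerivAt_right [DecidableEq κ] (h : BoundedSignal P x f B) (hg : IsBoundedBy P g C)
    (s y : κ → ℝ) (k : κ) (a : ℝ) :
    HasDerivAt (fun a => T g s (y + Pi.single k a))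
      (s k * T (fun ω => g ω * x ω k) s (y + Pi.single k a)) a := by
  have h1 : HasDerivAt (fun a : ℝ => (s, y + Pi.single k a)) (0, Pi.single k 1) a :=
    (hasDerivAt_const a s).prodMk ((hasDerivAt_single k a).const_add y)
  refine ((hasFDerivAt_tiltedIntegral h.measurable h.ae_coord_le hg.1 hg.2
    (s, y + Pi.single k a)).comp_hasDerivAt a h1).congr_deriv ?_
  simp [Pi.single_apply]

theorem partition_pos (h : BoundedSignal P x f B) (s y : κ → ℝ) : 0 < T (fun _ => 1) s y := by
  have h1 := h.integrable isBoundedBy_one s y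
  simp only [tiltedIntegral, one_mul] at h1 ⊢
  exact integral_exp_pos h1

theorem abs_tiltedIntegral_le (h : BoundedSignal P x f B) (hg : IsBoundedBy P g C)
    (s y : κ → ℝ) : |T g s y| ≤ C * T (fun _ => 1) s y := by
  have h1 := h.integrable isBoundedBy_one s y
  simp only [tiltedIntegral, one_mul] at h1 ⊢
  rw [← integral_const_mul, ← norm_eq_abs]
  refine norm_integral_le_of_norm_le (h1.const_mul C) ?_
  filter_upwards [hg.2] with ω hω
  rw [norm_mul, norm_eq_abs, norm_eq_abs, abs_exp]
  gcongr

theorem partition_le (h : BoundedSignal P x f B) {S : ℝ} {s : κ → ℝ} (hs : ∀ k, |s k| ≤ S)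
    (y : κ → ℝ) : T (fun _ => 1) s y ≤ exp (S * B * ∑ k, |y k|) := by
  have h1 := h.integrable isBoundedBy_one s y
  simp only [tiltedIntegral, one_mul] at h1 ⊢
  calc ∫ ω, exp (channelExponent s y (x ω)) ∂P ≤ ∫ _, exp (S * B * ∑ k, |y k|) ∂P := by
        refine integral_mono_ae h1 (integrable_const _) ?_
        filter_upwards [h.ae_coord_le] with ω hω
        exact exp_le_exp.2 (channelExponent_le hs hω y)
    _ = _ := by simp

theorem integrable_prod (h : BoundedSignal P x f B) (hg : IsBoundedBy P g C)
    {F : (κ → ℝ) → ℝ} {C' : ℝ} (hF : Measurable F) (hF' : ∀ y, |F y| ≤ C') (s : κ → ℝ) :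
    Integrable (fun q : (κ → ℝ) × Ω => F q.1 * (g q.2 * exp (channelExponent s q.1 (x q.2))))
      ((gaussianPi κ).prod P) := by
  have hexp : Measurable fun q : (κ → ℝ) × Ω => exp (channelExponent s q.1 (x q.2)) :=
    measurable_exp.comp (continuous_channelExponent.measurable.comp
      ((measurable_const.prodMk measurable_fst).prodMk (h.measurable.comp measurable_snd)))
  have hq : Measure.QuasiMeasurePreserving Prod.snd ((gaussianPi κ).prod P) P :=
    Measure.quasiMeasurePreserving_snd
  have hdom : Integrable (fun q : (κ → ℝ) × Ω =>
      C' * (C * exp (‖s‖ * B * ∑ k, |q.1 k|))) ((gaussianPi κ).prod P) :=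
    (((integrable_exp_sum_abs (κ := κ) (‖s‖ * B)).const_mul C).const_mul C').comp_fst P
  refine hdom.mono' ((hF.comp measurable_fst).aestronglyMeasurable.mul
    ((hg.1.comp_quasiMeasurePreserving hq).mul hexp.aestronglyMeasurable)) ?_
  filter_upwards [hq.ae h.ae_coord_le, hq.ae hg.2] with q hx hgq
  rw [norm_mul, norm_mul, norm_eq_abs, norm_eq_abs, norm_eq_abs, abs_exp]
  have h1 := channelExponent_le (fun k => norm_le_pi_norm s k) hx q.1
  have := exp_le_exp.2 h1
  have h2 := (abs_nonneg _).trans (hF' q.1)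
  have h3 := (abs_nonneg _).trans hgq
  gcongr
  exact hF' _

/-- The expectation under the joint law of signal and observation, as an integral over the
observation alone. -/
theorem integral_mul_integral_add (h : BoundedSignal P x f B) (hg : IsBoundedBy P g C)
    {F : (κ → ℝ) → ℝ} {C' : ℝ} (hF : Measurable F) (hF' : ∀ y, |F y| ≤ C') (s : κ → ℝ) :
    ∫ ω, g ω * ∫ z, F (z + s * x ω) ∂gaussianPi κ ∂P = ∫ y, F y * T g s y ∂gaussianPi κ := by
  have h1 : ∀ y, F y * T g s y = ∫ ω, F y * (g ω * exp (channelExponent s y (x ω))) ∂P :=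
    fun y => (integral_const_mul _ _).symm
  simp only [h1]
  rw [integral_integral_swap (h.integrable_prod hg hF hF' s)]
  refine integral_congr_ae (ae_of_all _ fun ω => ?_)
  simp only
  rw [integral_gaussianPi_add, ← integral_const_mul]
  refine integral_congr_ae (ae_of_all _ fun y => ?_)
  simp only [channelExponent, Pi.mul_apply, mul_pow]
  ring

theorem integral_partition (h : BoundedSignal P x f B) (s : κ → ℝ) :
    ∫ y, T (fun _ => 1) s y ∂gaussianPi κ = 1 := by
  have := h.integral_mul_integral_add isBoundedBy_one (F := fun _ => 1) measurable_const
    (C' := 1) (by simp) s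
  simpa using this.symm

end BoundedSignal

/-- The posterior mean of `g` given the observation `y`. -/
def posteriorMean (P : Measure Ω) (x : Ω → κ → ℝ) (g : Ω → ℝ) (s y : κ → ℝ) : ℝ :=
  tiltedIntegral P x g s y / tiltedIntegral P x (fun _ => 1) s y

/-- The linearization of `(a, z) ↦ a² / z` at `(∫ f, ∫ 1)` applied to `(∫ f g, ∫ g)`, for the
unnormalized posterior. -/
def linearizedOverlap (P : Measure Ω) (x : Ω → κ → ℝ) (f g : Ω → ℝ) (s y : κ → ℝ) : ℝ :=
  2 * posteriorMean P x f s y * tiltedIntegral P x (fun ω => f ω * g ω) s y -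
    posteriorMean P x f s y ^ 2 * tiltedIntegral P x g s y

/-- The squared posterior covariance of `f` and the `k`-th coordinate of the signal, weighted by
the density of the observation. -/
def sqCovariance (P : Measure Ω) (x : Ω → κ → ℝ) (f : Ω → ℝ) (k : κ) (s y : κ → ℝ) : ℝ :=
  (tiltedIntegral P x (fun ω => f ω * x ω k) s y -
    posteriorMean P x f s y * tiltedIntegral P x (fun ω => x ω k) s y) ^ 2 /
      tiltedIntegral P x (fun _ => 1) s y

/-- The expected overlap `E[f ⟨f⟩]` as a function of the signal strengths. -/
def expectedOverlap (P : Measure Ω) (x : Ω → κ → ℝ) (f : Ω → ℝ) (s : κ → ℝ) : ℝ :=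
  ∫ y, tiltedIntegral P x f s y ^ 2 / tiltedIntegral P x (fun _ => 1) s y ∂gaussianPi κ

/-- The expected squared posterior covariance of `f` and the `k`-th coordinate of the signal. -/
def expectedSqCovariance (P : Measure Ω) (x : Ω → κ → ℝ) (f : Ω → ℝ) (k : κ) (s : κ → ℝ) : ℝ :=
  ∫ y, sqCovariance P x f k s y ∂gaussianPi κ

namespace BoundedSignal

local notation "T" => tiltedIntegral P x

theorem continuous_posteriorMean (h : BoundedSignal P x f B) :
    Continuous fun p : (κ → ℝ) × (κ → ℝ) => posteriorMean P x f p.1 p.2 :=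
  (h.continuous_tiltedIntegral h.isBoundedBy).div (h.continuous_tiltedIntegral isBoundedBy_one)
    fun p => (h.partition_pos p.1 p.2).ne'

theorem abs_posteriorMean_le (h : BoundedSignal P x f B) (s y : κ → ℝ) :
    |posteriorMean P x f s y| ≤ B := by
  have h1 := h.abs_tiltedIntegral_le h.isBoundedBy s y
  rwa [posteriorMean, abs_div, abs_of_pos (h.partition_pos s y), div_le_iff₀ (h.partition_pos s y)]

theorem continuous_linearizedOverlap (h : BoundedSignal P x f B) {C C' : ℝ}
    (hg : IsBoundedBy P g C) (hfg : IsBoundedBy P (fun ω => f ω * g ω) C') :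
    Continuous fun p : (κ → ℝ) × (κ → ℝ) => linearizedOverlap P x f g p.1 p.2 :=
  ((h.continuous_posteriorMean.const_mul 2).mul (h.continuous_tiltedIntegral hfg)).sub
    ((h.continuous_posteriorMean.pow 2).mul (h.continuous_tiltedIntegral hg))

theorem continuous_sqCovariance (h : BoundedSignal P x f B) (k : κ) :
    Continuous fun p : (κ → ℝ) × (κ → ℝ) => sqCovariance P x f k p.1 p.2 :=
  (((h.continuous_tiltedIntegral (h.isBoundedBy_mul h.isBoundedBy k)).sub
    (h.continuous_posteriorMean.mul (h.continuous_tiltedIntegral (h.isBoundedBy_coord k)))).pow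
    2).div (h.continuous_tiltedIntegral isBoundedBy_one) fun p => (h.partition_pos p.1 p.2).ne'

theorem abs_linearizedOverlap_le (h : BoundedSignal P x f B) {C : ℝ}
    (hg : IsBoundedBy P g C) (hfg : IsBoundedBy P (fun ω => f ω * g ω) (B * C)) (s y : κ → ℝ) :
    |linearizedOverlap P x f g s y| ≤ 3 * B ^ 2 * C * T (fun _ => 1) s y := by
  have hm := h.abs_posteriorMean_le s y
  have h1 := h.abs_tiltedIntegral_le hg s y
  have h2 := h.abs_tiltedIntegral_le hfg s y
  have hB : 0 ≤ B := by linarith [h.one_le]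
  rw [linearizedOverlap]
  refine (abs_sub _ _).trans ?_
  rw [abs_mul, abs_mul, abs_mul, abs_pow, abs_two]
  calc 2 * |posteriorMean P x f s y| * |T (fun ω => f ω * g ω) s y| +
        |posteriorMean P x f s y| ^ 2 * |T g s y|
      ≤ 2 * B * (B * C * T (fun _ => 1) s y) + B ^ 2 * (C * T (fun _ => 1) s y) := by gcongr
    _ = _ := by ring

theorem sqCovariance_nonneg (h : BoundedSignal P x f B) (k : κ) (s y : κ → ℝ) :
    0 ≤ sqCovariance P x f k s y :=
  div_nonneg (sq_nonneg _) (h.partition_pos s y).le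

theorem abs_sqCovariance_le (h : BoundedSignal P x f B) (k : κ) (s y : κ → ℝ) :
    |sqCovariance P x f k s y| ≤ 4 * B ^ 4 * T (fun _ => 1) s y := by
  have hZ := h.partition_pos s y
  have hm := h.abs_posteriorMean_le s y
  have h1 := h.abs_tiltedIntegral_le (h.isBoundedBy_coord k) s y
  have h2 := h.abs_tiltedIntegral_le (h.isBoundedBy_mul h.isBoundedBy k) s y
  have hB : 0 ≤ B := by linarith [h.one_le]
  rw [abs_of_nonneg (h.sqCovariance_nonneg k s y), sqCovariance, div_le_iff₀ hZ, ← sq_abs]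
  have h3 : |T (fun ω => f ω * x ω k) s y - posteriorMean P x f s y * T (fun ω => x ω k) s y| ≤
      2 * B ^ 2 * T (fun _ => 1) s y := by
    refine (abs_sub _ _).trans ?_
    rw [abs_mul]
    calc |T (fun ω => f ω * x ω k) s y| + |posteriorMean P x f s y| * |T (fun ω => x ω k) s y|
        ≤ B * B * T (fun _ => 1) s y + B * (B * T (fun _ => 1) s y) := by gcongr
      _ = _ := by ring
  calc _ ≤ (2 * B ^ 2 * T (fun _ => 1) s y) ^ 2 := by gcongr
    _ = _ := by ring

theorem abs_sq_div_le (h : BoundedSignal P x f B) (s y : κ → ℝ) :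
    |T f s y ^ 2 / T (fun _ => 1) s y| ≤ B ^ 2 * T (fun _ => 1) s y := by
  have hZ := h.partition_pos s y
  have h1 := h.abs_tiltedIntegral_le h.isBoundedBy s y
  rw [abs_div, abs_of_pos hZ, div_le_iff₀ hZ, abs_pow]
  calc |T f s y| ^ 2 ≤ (B * T (fun _ => 1) s y) ^ 2 := by gcongr
    _ = _ := by ring

theorem continuous_sq_div (h : BoundedSignal P x f B) :
    Continuous fun p : (κ → ℝ) × (κ → ℝ) => T f p.1 p.2 ^ 2 / T (fun _ => 1) p.1 p.2 :=
  ((h.continuous_tiltedIntegral h.isBoundedBy).pow 2).div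
    (h.continuous_tiltedIntegral isBoundedBy_one) fun p => (h.partition_pos p.1 p.2).ne'

theorem integrable_of_abs_le (h : BoundedSignal P x f B) {Φ : (κ → ℝ) → ℝ} {C : ℝ} {s : κ → ℝ}
    (hC : 0 ≤ C) (hΦ : Continuous Φ) (hb : ∀ y, |Φ y| ≤ C * T (fun _ => 1) s y) :
    Integrable Φ (gaussianPi κ) :=
  integrable_of_abs_le_exp (C := C) (M := ‖s‖ * B) hΦ fun y => (hb y).trans
    (mul_le_mul_of_nonneg_left (h.partition_le (fun k => norm_le_pi_norm s k) y) hC)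

theorem abs_integral_le (h : BoundedSignal P x f B) {Φ : (κ → ℝ) → ℝ} {C : ℝ} {s : κ → ℝ}
    (hb : ∀ y, |Φ y| ≤ C * T (fun _ => 1) s y) :
    |∫ y, Φ y ∂gaussianPi κ| ≤ C := by
  have hZ : Integrable (fun y => T (fun _ => 1) s y) (gaussianPi κ) :=
    h.integrable_of_abs_le (C := 1) zero_le_one
      ((h.continuous_tiltedIntegral isBoundedBy_one).comp (.prodMk_right s)) fun y => by
        rw [one_mul, abs_of_pos (h.partition_pos s y)]
  calc ‖∫ y, Φ y ∂gaussianPi κ‖ ≤ ∫ y, C * T (fun _ => 1) s y ∂gaussianPi κ :=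
        norm_integral_le_of_norm_le (hZ.const_mul C) (ae_of_all _ hb)
    _ = C := by rw [integral_const_mul, h.integral_partition, mul_one]

theorem continuous_integral (h : BoundedSignal P x f B) {Φ : (κ → ℝ) × (κ → ℝ) → ℝ} {C : ℝ}
    (hC : 0 ≤ C) (hΦ : Continuous Φ) (hb : ∀ s y, |Φ (s, y)| ≤ C * T (fun _ => 1) s y) :
    Continuous fun s => ∫ y, Φ (s, y) ∂gaussianPi κ := by
  refine continuous_iff_continuousAt.2 fun s₀ => ?_
  refine continuousAt_of_dominated
    (bound := fun y => C * exp ((‖s₀‖ + 1) * B * ∑ k, |y k|))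
    (.of_forall fun s => (hΦ.comp (.prodMk_right s)).aestronglyMeasurable) ?_
    ((integrable_exp_sum_abs _).const_mul C)
    (ae_of_all _ fun y => (hΦ.comp (.prodMk_left y)).continuousAt)
  filter_upwards [Metric.closedBall_mem_nhds s₀ one_pos] with s hs
  refine ae_of_all _ fun y => (hb s y).trans (mul_le_mul_of_nonneg_left
    (h.partition_le (fun k => ?_) y) hC)
  rw [mem_closedBall_iff_norm] at hs
  have := norm_le_pi_norm s k
  rw [norm_eq_abs] at this
  linarith [norm_sub_norm_le s s₀]

theorem continuous_expectedOverlap (h : BoundedSignal P x f B) :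
    Continuous (expectedOverlap P x f) :=
  h.continuous_integral (sq_nonneg B) h.continuous_sq_div fun s y => h.abs_sq_div_le s y

theorem continuous_expectedSqCovariance (h : BoundedSignal P x f B) (k : κ) :
    Continuous (expectedSqCovariance P x f k) :=
  h.continuous_integral h.four_mul_pow_nonneg (h.continuous_sqCovariance k)
    fun s y => h.abs_sqCovariance_le k s y

theorem expectedSqCovariance_nonneg (h : BoundedSignal P x f B) (k : κ) (s : κ → ℝ) :
    0 ≤ expectedSqCovariance P x f k s :=
  integral_nonneg fun y => h.sqCovariance_nonneg k s y

theorem expectedSqCovariance_le (h : BoundedSignal P x f B) (k : κ) (s : κ → ℝ) :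
    expectedSqCovariance P x f k s ≤ 4 * B ^ 4 :=
  (le_abs_self _).trans (h.abs_integral_le fun y => h.abs_sqCovariance_le k s y)

theorem expectedOverlap_nonneg (h : BoundedSignal P x f B) (s : κ → ℝ) :
    0 ≤ expectedOverlap P x f s :=
  integral_nonneg fun y => div_nonneg (sq_nonneg _) (h.partition_pos s y).le

theorem continuous_section {α : Type*} [TopologicalSpace α] {F : α → α → ℝ}
    (hF : Continuous fun p : α × α => F p.1 p.2) (s : α) :
    Continuous fun y => F s y :=
  hF.comp (.prodMk_right s)

theorem hasFDerivAt_sq_div {E : Type*} [NormedAddCommGroup E] [NormedSpace ℝ E] {a z : E → ℝ}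
    {a' z' : E →L[ℝ] ℝ} {p : E} (ha : HasFDerivAt a a' p) (hz : HasFDerivAt z z' p)
    (hp : z p ≠ 0) : HasFDerivAt (fun p => a p ^ 2 / z p)
      ((2 * (a p / z p)) • a' - (a p / z p) ^ 2 • z') p := by
  refine ((ha.pow 2).mul ((hasDerivAt_inv hp).comp_hasFDerivAt p hz)).congr_fderiv ?_
  ext v
  simp
  field_simp
  ring

theorem hasFDerivAt_sq_div_partition (h : BoundedSignal P x f B) (s y : κ → ℝ) :
    HasFDerivAt (fun s => T f s y ^ 2 / T (fun _ => 1) s y)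
      (∑ k, (y k * linearizedOverlap P x f (fun ω => x ω k) s y -
        s k * linearizedOverlap P x f (fun ω => x ω k ^ 2) s y) •
          (ContinuousLinearMap.proj k : (κ → ℝ) →L[ℝ] ℝ)) s := by
  refine (hasFDerivAt_sq_div (h.hasFDerivAt_left h.isBoundedBy s y)
    (h.hasFDerivAt_left isBoundedBy_one s y) (h.partition_pos s y).ne').congr_fderiv ?_
  rw [Finset.smul_sum, Finset.smul_sum, ← Finset.sum_sub_distrib]
  refine Finset.sum_congr rfl fun k _ => ?_
  simp only [linearizedOverlap, posteriorMean, one_mul]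
  module

theorem hasDerivAt_linearizedOverlap [DecidableEq κ] (h : BoundedSignal P x f B) (s y : κ → ℝ)
    (k : κ) (a : ℝ) :
    HasDerivAt (fun a => linearizedOverlap P x f (fun ω => x ω k) s (y + Pi.single k a))
      (s k * (2 * sqCovariance P x f k s (y + Pi.single k a) +
        linearizedOverlap P x f (fun ω => x ω k ^ 2) s (y + Pi.single k a))) a := by
  have hZ := h.partition_pos s (y + Pi.single k a)
  have hf := h.hasDerivAt_right h.isBoundedBy s y k a
  have h1 := h.hasDerivAt_right isBoundedBy_one s y k a
  have hx := h.hasDerivAt_right (h.isBoundedBy_coord k) s y k a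
  have hfx := h.hasDerivAt_right (h.isBoundedBy_mul h.isBoundedBy k) s y k a
  have hm := hf.fun_div h1 hZ.ne'
  refine (((hm.const_mul 2).mul hfx).sub ((hm.pow 2).mul hx)).congr_deriv ?_
  simp only [linearizedOverlap, sqCovariance, posteriorMean, one_mul, mul_assoc, ← pow_two]
  simp
  field_simp
  ring

theorem continuous_linearizedOverlap_coord (h : BoundedSignal P x f B) (k : κ) :
    Continuous fun p : (κ → ℝ) × (κ → ℝ) => linearizedOverlap P x f (fun ω => x ω k) p.1 p.2 :=
  h.continuous_linearizedOverlap (h.isBoundedBy_coord k) (h.isBoundedBy_mul h.isBoundedBy k)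

theorem continuous_linearizedOverlap_coord_sq (h : BoundedSignal P x f B) (k : κ) :
    Continuous fun p : (κ → ℝ) × (κ → ℝ) =>
      linearizedOverlap P x f (fun ω => x ω k ^ 2) p.1 p.2 :=
  h.continuous_linearizedOverlap (h.isBoundedBy_coord_sq k)
    (h.isBoundedBy_mul_sq h.isBoundedBy k)

theorem abs_linearizedOverlap_coord_le (h : BoundedSignal P x f B) (k : κ) (s y : κ → ℝ) :
    |linearizedOverlap P x f (fun ω => x ω k) s y| ≤ 4 * B ^ 4 * T (fun _ => 1) s y := by
  refine (h.abs_linearizedOverlap_le (h.isBoundedBy_coord k)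
    (h.isBoundedBy_mul h.isBoundedBy k) s y).trans ?_
  have hZ := (h.partition_pos s y).le
  have hB := h.one_le
  refine mul_le_mul_of_nonneg_right ?_ hZ
  nlinarith [pow_pos (zero_lt_one.trans_le hB) 3]

theorem abs_linearizedOverlap_coord_sq_le (h : BoundedSignal P x f B) (k : κ) (s y : κ → ℝ) :
    |linearizedOverlap P x f (fun ω => x ω k ^ 2) s y| ≤ 4 * B ^ 4 * T (fun _ => 1) s y := by
  refine (h.abs_linearizedOverlap_le (h.isBoundedBy_coord_sq k)
    (h.isBoundedBy_mul_sq h.isBoundedBy k) s y).trans ?_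
  have hZ := (h.partition_pos s y).le
  refine mul_le_mul_of_nonneg_right ?_ hZ
  nlinarith [sq_nonneg (B ^ 2)]

theorem integrable_linearizedOverlap_coord_sq (h : BoundedSignal P x f B) (k : κ) (s : κ → ℝ) :
    Integrable (fun y => linearizedOverlap P x f (fun ω => x ω k ^ 2) s y) (gaussianPi κ) :=
  h.integrable_of_abs_le h.four_mul_pow_nonneg
    (continuous_section (h.continuous_linearizedOverlap_coord_sq k) s)
    fun y => h.abs_linearizedOverlap_coord_sq_le k s y

theorem integrable_sqCovariance (h : BoundedSignal P x f B) (k : κ) (s : κ → ℝ) :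
    Integrable (fun y => sqCovariance P x f k s y) (gaussianPi κ) :=
  h.integrable_of_abs_le h.four_mul_pow_nonneg
    (continuous_section (h.continuous_sqCovariance k) s) fun y => h.abs_sqCovariance_le k s y

theorem norm_deriv_sq_div_le (h : BoundedSignal P x f B) {S : ℝ} {s : κ → ℝ} (hs : ‖s‖ ≤ S)
    (y : κ → ℝ) (k : κ) :
    |y k * linearizedOverlap P x f (fun ω => x ω k) s y -
        s k * linearizedOverlap P x f (fun ω => x ω k ^ 2) s y| ≤
      (1 + S) * (4 * B ^ 4) * exp ((S * B + 1) * ∑ k, |y k|) := by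
  have h0 := h.four_mul_pow_nonneg
  have hS : ∀ k, |s k| ≤ S := fun k => (norm_le_pi_norm s k).trans hs
  have hS0 : 0 ≤ S := (norm_nonneg s).trans hs
  have hZ := h.partition_le hS y
  have hy : |y k| ≤ exp (∑ k, |y k|) :=
    (Finset.single_le_sum (f := fun k => |y k|) (fun _ _ => abs_nonneg _)
      (Finset.mem_univ k)).trans (by linarith [add_one_le_exp (∑ k, |y k|)])
  have hy1 : 1 ≤ exp (∑ k, |y k|) :=
    one_le_exp (Finset.sum_nonneg fun _ _ => abs_nonneg _)
  have h1 := (h.abs_linearizedOverlap_coord_le k s y).trans (mul_le_mul_of_nonneg_left hZ h0)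
  have h2 := (h.abs_linearizedOverlap_coord_sq_le k s y).trans (mul_le_mul_of_nonneg_left hZ h0)
  rw [add_one_mul (S * B), exp_add]
  refine (abs_sub _ _).trans ?_
  rw [abs_mul, abs_mul]
  set E := exp (S * B * ∑ k, |y k|)
  set e := exp (∑ k, |y k|)
  have hE : 0 ≤ 4 * B ^ 4 * E := mul_nonneg h0 (exp_pos _).le
  calc _ ≤ e * (4 * B ^ 4 * E) + S * e * (4 * B ^ 4 * E) := by
        gcongr
        exact (hS k).trans (le_mul_of_one_le_right hS0 hy1)
    _ = _ := by ring

theorem integrable_deriv_sq_div (h : BoundedSignal P x f B) (k : κ) (s : κ → ℝ) :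
    Integrable (fun y => y k * linearizedOverlap P x f (fun ω => x ω k) s y -
      s k * linearizedOverlap P x f (fun ω => x ω k ^ 2) s y) (gaussianPi κ) :=
  integrable_of_abs_le_exp
    (((continuous_apply k).mul (continuous_section (h.continuous_linearizedOverlap_coord k) s)).sub
      ((continuous_section (h.continuous_linearizedOverlap_coord_sq k) s).const_mul (s k)))
    fun y => h.norm_deriv_sq_div_le le_rfl y k

theorem integral_deriv_sq_div (h : BoundedSignal P x f B) (k : κ) (s : κ → ℝ) :
    ∫ y, (y k * linearizedOverlap P x f (fun ω => x ω k) s y -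
        s k * linearizedOverlap P x f (fun ω => x ω k ^ 2) s y) ∂gaussianPi κ =
      2 * s k * expectedSqCovariance P x f k s := by
  classical
  have h0 := h.four_mul_pow_nonneg
  have hs : ∀ k, |s k| ≤ ‖s‖ := norm_le_pi_norm s
  have hE : ∀ y : κ → ℝ, 0 ≤ exp (‖s‖ * B * ∑ k, |y k|) := fun y => (exp_pos _).le
  have hB := h.one_le
  have hsub := h.integrable_linearizedOverlap_coord_sq k s
  have hcov := h.integrable_sqCovariance k s
  have key := integral_coord_mul_gaussianPi (k := k)
    (F := fun y => linearizedOverlap P x f (fun ω => x ω k) s y)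
    (F' := fun y => s k * (2 * sqCovariance P x f k s y +
      linearizedOverlap P x f (fun ω => x ω k ^ 2) s y))
    (C := (3 * ‖s‖ + 1) * (4 * B ^ 4)) (M := ‖s‖ * B) (by positivity) (by positivity)
    (continuous_section (h.continuous_linearizedOverlap_coord k) s)
    ((((continuous_section (h.continuous_sqCovariance k) s).const_mul 2).add
      (continuous_section (h.continuous_linearizedOverlap_coord_sq k) s)).const_mul (s k))
    (fun y => ?_) (fun y => ?_) fun y a => h.hasDerivAt_linearizedOverlap s y k a
  · have hi : Integrable (fun y => y k * linearizedOverlap P x f (fun ω => x ω k) s y)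
        (gaussianPi κ) :=
      ((h.integrable_deriv_sq_div k s).add (hsub.const_mul (s k))).congr
        (ae_of_all _ fun y => by simp)
    rw [integral_sub hi (hsub.const_mul _), key, integral_const_mul, integral_const_mul,
      integral_add (hcov.const_mul 2) hsub, integral_const_mul, expectedSqCovariance]
    ring
  · refine (h.abs_linearizedOverlap_coord_le k s y).trans
      ((mul_le_mul_of_nonneg_left (h.partition_le hs y) h0).trans ?_)
    have := mul_nonneg (mul_nonneg (norm_nonneg s) h0) (hE y)
    linarith
  · have h1 := (h.abs_sqCovariance_le k s y).trans
      (mul_le_mul_of_nonneg_left (h.partition_le hs y) h0)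
    have h2 := (h.abs_linearizedOverlap_coord_sq_le k s y).trans
      (mul_le_mul_of_nonneg_left (h.partition_le hs y) h0)
    have h3 := mul_nonneg h0 (hE y)
    rw [abs_mul]
    calc _ ≤ ‖s‖ * (3 * (4 * B ^ 4 * exp (‖s‖ * B * ∑ k, |y k|))) := by
          gcongr
          · exact hs k
          · refine (abs_add_le _ _).trans ?_
            rw [abs_mul, abs_two]
            linarith
      _ ≤ _ := by linarith

theorem hasFDerivAt_integral_of_partial {Φ : (κ → ℝ) → (κ → ℝ) → ℝ} {s : κ → ℝ}
    {c : κ → (κ → ℝ) → (κ → ℝ) → ℝ} {K M : ℝ}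
    (hΦ : ∀ s, Integrable (Φ s) (gaussianPi κ)) (hc : ∀ k, Integrable (c k s) (gaussianPi κ))
    (hd : ∀ s y, HasFDerivAt (fun s => Φ s y)
      (∑ k, c k s y • (ContinuousLinearMap.proj k : (κ → ℝ) →L[ℝ] ℝ)) s)
    (hb : ∀ s' ∈ Metric.closedBall s 1, ∀ y k, |c k s' y| ≤ K * exp (M * ∑ k, |y k|)) :
    HasFDerivAt (fun s => ∫ y, Φ s y ∂gaussianPi κ)
      (∑ k, (∫ y, c k s y ∂gaussianPi κ) •
        (ContinuousLinearMap.proj k : (κ → ℝ) →L[ℝ] ℝ)) s := by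
  set L : κ → (κ → ℝ) →L[ℝ] ℝ := fun k => ContinuousLinearMap.proj k
  have hint : ∀ k, Integrable (fun y => c k s y • L k) (gaussianPi κ) :=
    fun k => (hc k).smul_const _
  have hsum : Integrable (fun y => ∑ k, c k s y • L k) (gaussianPi κ) :=
    integrable_finsetSum (f := fun k y => c k s y • L k) _ fun k _ => hint k
  have hbound : ∀ y, ∀ s' ∈ Metric.closedBall s 1,
      ‖∑ k, c k s' y • L k‖ ≤ (∑ k, ‖L k‖) * (K * exp (M * ∑ k, |y k|)) := fun y s' hs' => by
    refine (norm_sum_le _ _).trans ?_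
    rw [Finset.sum_mul]
    refine Finset.sum_le_sum fun k _ => ?_
    rw [norm_smul, mul_comm]
    exact mul_le_mul_of_nonneg_left (hb s' hs' y k) (norm_nonneg _)
  have hi : Integrable (fun y : κ → ℝ => (∑ k, ‖L k‖) * (K * exp (M * ∑ k, |y k|)))
      (gaussianPi κ) := ((integrable_exp_sum_abs M).const_mul K).const_mul _
  have hD := hasFDerivAt_integral_of_dominated_of_fderiv_le (μ := gaussianPi κ) (𝕜 := ℝ)
    (x₀ := s) (F := Φ) (F' := fun s y => ∑ k, c k s y • L k)
    (Metric.closedBall_mem_nhds s one_pos)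
    (.of_forall fun s => (hΦ s).aestronglyMeasurable) (hΦ s) hsum.aestronglyMeasurable
    (ae_of_all _ hbound) hi (ae_of_all _ fun y s' _ => hd s' y)
  refine hD.congr_fderiv ?_
  rw [integral_finsetSum _ fun k _ => hint k]
  exact Finset.sum_congr rfl fun k _ => integral_smul_const _ _

theorem integrable_sq_div (h : BoundedSignal P x f B) (s : κ → ℝ) :
    Integrable (fun y => T f s y ^ 2 / T (fun _ => 1) s y) (gaussianPi κ) :=
  h.integrable_of_abs_le (sq_nonneg B)
    (continuous_section (F := fun s y => T f s y ^ 2 / T (fun _ => 1) s y) h.continuous_sq_div s)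
    fun y => h.abs_sq_div_le s y

theorem hasFDerivAt_expectedOverlap (h : BoundedSignal P x f B) (s : κ → ℝ) :
    HasFDerivAt (expectedOverlap P x f)
      (∑ k, (2 * s k * expectedSqCovariance P x f k s) •
        (ContinuousLinearMap.proj k : (κ → ℝ) →L[ℝ] ℝ)) s := by
  have key := hasFDerivAt_integral_of_partial h.integrable_sq_div
    (fun k => h.integrable_deriv_sq_div k s) h.hasFDerivAt_sq_div_partition
    fun s' hs' y k => h.norm_deriv_sq_div_le (S := ‖s‖ + 1) ?_ y k
  · simp only [h.integral_deriv_sq_div] at key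
    exact key
  · rw [mem_closedBall_iff_norm] at hs'
    linarith [norm_sub_norm_le s' s]

theorem sq_div_partition_le (h : BoundedSignal P x f B) (s y : κ → ℝ) :
    T f s y ^ 2 / T (fun _ => 1) s y ≤ T (fun ω => f ω ^ 2) s y := by
  have hZ := h.partition_pos s y
  set m := T f s y / T (fun _ => 1) s y with hm
  have h0 : 0 ≤ ∫ ω, (f ω - m) ^ 2 * exp (channelExponent s y (x ω)) ∂P :=
    integral_nonneg fun ω => by positivity
  have h1 : ∫ ω, (f ω - m) ^ 2 * exp (channelExponent s y (x ω)) ∂P =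
      T (fun ω => f ω ^ 2) s y - 2 * m * T f s y + m ^ 2 * T (fun _ => 1) s y := by
    have hi := (h.integrable h.isBoundedBy s y).const_mul (2 * m)
    have hi' := (h.integrable isBoundedBy_one s y).const_mul (m ^ 2)
    simp only [tiltedIntegral]
    rw [← integral_const_mul, ← integral_const_mul,
      ← integral_sub (h.integrable h.isBoundedBy_sq s y) hi]
    refine Eq.trans ?_ (integral_add ((h.integrable h.isBoundedBy_sq s y).sub hi) hi')
    refine integral_congr_ae (ae_of_all _ fun ω => ?_)
    simp only
    ring
  have h2 : 2 * m * T f s y - m ^ 2 * T (fun _ => 1) s y =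
      T f s y ^ 2 / T (fun _ => 1) s y := by
    rw [hm]
    field_simp
    ring
  linarith

theorem sum_expectedOverlap_le {ι : Type*} [Fintype ι] {f : ι → Ω → ℝ}
    (h : ∀ i, BoundedSignal P x (f i) B) (i₀ : ι) {K : ℝ} (hK : ∀ᵐ ω ∂P, ∑ i, f i ω ^ 2 = K)
    (s : κ → ℝ) : ∑ i, expectedOverlap P x (f i) s ≤ K := by
  have hsum : ∀ y, ∑ i, T (fun ω => f i ω ^ 2) s y = K * T (fun _ => 1) s y := by
    intro y
    simp only [tiltedIntegral]
    rw [← integral_finsetSum, ← integral_const_mul]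
    · refine integral_congr_ae ?_
      filter_upwards [hK] with ω hω
      rw [← Finset.sum_mul, hω, one_mul]
    · intro i _
      exact (h i).integrable (h i).isBoundedBy_sq s y
  have hZ := (h i₀).integrable_of_abs_le (C := 1) (s := s) zero_le_one
    (continuous_section (F := fun s y => T (fun _ => 1) s y)
      ((h i₀).continuous_tiltedIntegral isBoundedBy_one) s) fun y => by
        rw [one_mul, abs_of_pos ((h i₀).partition_pos s y)]
  simp only [expectedOverlap]
  rw [← integral_finsetSum _ fun i _ => (h i).integrable_sq_div s]
  calc _ ≤ ∫ y, K * T (fun _ => 1) s y ∂gaussianPi κ := by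
        refine integral_mono (integrable_finsetSum _ fun i _ => (h i).integrable_sq_div s)
          (hZ.const_mul K) fun y => ?_
        simp only
        rw [← hsum]
        exact Finset.sum_le_sum fun i _ => (h i).sq_div_partition_le s y
    _ = K := by rw [integral_const_mul, (h i₀).integral_partition, mul_one]

/-- The Nishimori-type identity expressing the expected overlap of `f` with its posterior mean. -/
theorem integral_mul_posteriorMean (h : BoundedSignal P x f B) (s : κ → ℝ) :
    ∫ ω, f ω * ∫ z, posteriorMean P x f s (z + s * x ω) ∂gaussianPi κ ∂P =
      expectedOverlap P x f s := by
  rw [h.integral_mul_integral_add h.isBoundedBy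
    (continuous_section h.continuous_posteriorMean s).measurable (h.abs_posteriorMean_le s) s]
  refine integral_congr_ae (ae_of_all _ fun y => ?_)
  simp only [posteriorMean]
  ring
end BoundedSignal

end Tilt

/-! ### The rank-one channel -/

section RankOne

variable {n nu nv : ℕ} {au av t : ℝ} {R : ℝ × ℝ} {Pu : Measure (Fin nu → ℝ)}
  {Pv : Measure (Fin nv → ℝ)}

/-- The coordinates of the observations `(Y, Ỹ, Ȳ)`. -/
abbrev ObsIndex (nu nv : ℕ) : Type := (Fin nu × Fin nv) ⊕ (Fin nu ⊕ Fin nv)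

/-- A matrix and two vectors assembled into a single vector. -/
def packObs (q : (Fin nu → Fin nv → ℝ) × (Fin nu → ℝ) × (Fin nv → ℝ)) : ObsIndex nu nv → ℝ :=
  Sum.elim (fun p => q.1 p.1 p.2) (Sum.elim q.2.1 q.2.2)

/-- The noiseless observation of a pair of spikes. -/
def spikeSignal (ω : (Fin nu → ℝ) × (Fin nv → ℝ)) : ObsIndex nu nv → ℝ :=
  packObs (fun i j => ω.1 i * ω.2 j, ω.1, ω.2)

/-- The signal strengths of the interpolating model. -/
def obsStrength (n nu nv : ℕ) (au av t : ℝ) (R : ℝ × ℝ) : ObsIndex nu nv → ℝ :=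
  packObs (fun _ _ => √((1 - t) / n), fun _ => √(av * R.2), fun _ => √(au * R.1))

theorem continuous_packObs : Continuous (packObs (nu := nu) (nv := nv)) := by
  refine continuous_pi fun k => ?_
  rcases k with p | i | j <;> simp only [packObs, Sum.elim_inl, Sum.elim_inr] <;> fun_prop

theorem continuous_spikeSignal : Continuous (spikeSignal (nu := nu) (nv := nv)) :=
  continuous_packObs.comp (by fun_prop)

theorem continuous_obsStrength :
    Continuous fun p : ℝ × (ℝ × ℝ) => obsStrength n nu nv au av p.1 p.2 :=
  continuous_packObs.comp (by fun_prop)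

instance : IsProbabilityMeasure (stdGaussian nu) := by
  unfold stdGaussian
  infer_instance

instance : IsProbabilityMeasure (stdGaussianMat nu nv) := by
  unfold stdGaussianMat
  infer_instance

theorem map_packObs :
    ((stdGaussianMat nu nv).prod ((stdGaussian nu).prod (stdGaussian nv))).map packObs =
      gaussianPi (ObsIndex nu nv) := by
  refine (Measure.pi_eq fun A hA => ?_).symm
  rw [Measure.map_apply continuous_packObs.measurable (.univ_pi hA)]
  have : packObs ⁻¹' univ.pi A =
      (univ.pi fun i => univ.pi fun j => A (.inl (i, j))) ×ˢ
        ((univ.pi fun i => A (.inr (.inl i))) ×ˢ (univ.pi fun j => A (.inr (.inr j)))) := by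
    ext q
    simp [packObs, Set.mem_pi]
  rw [this, Measure.prod_prod, Measure.prod_prod, Fintype.prod_sum_type, Fintype.prod_sum_type,
    Fintype.prod_prod_type]
  simp only [stdGaussianMat, stdGaussian, Measure.pi_pi]

theorem integral_packObs {F : (ObsIndex nu nv → ℝ) → ℝ} {C : ℝ} (hF : Continuous F)
    (hC : ∀ y, |F y| ≤ C) :
    ∫ Z, ∫ Zt, ∫ Zb, F (packObs (Z, Zt, Zb)) ∂stdGaussian nv ∂stdGaussian nu
      ∂stdGaussianMat nu nv = ∫ z, F z ∂gaussianPi (ObsIndex nu nv) := by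
  have hc : Continuous fun q => F (packObs (nu := nu) (nv := nv) q) := hF.comp continuous_packObs
  have hi : Integrable (fun q => F (packObs q))
      ((stdGaussianMat nu nv).prod ((stdGaussian nu).prod (stdGaussian nv))) :=
    .of_bound hc.aestronglyMeasurable C (ae_of_all _ fun q => hC _)
  rw [← map_packObs, integral_map continuous_packObs.aemeasurable hF.aestronglyMeasurable,
    integral_prod _ hi]
  refine integral_congr_ae (ae_of_all _ fun Z => ?_)
  refine (integral_prod (fun q => F (packObs (Z, q))) ?_).symm
  exact .of_bound (hc.comp (.prodMk_right Z)).aestronglyMeasurable C (ae_of_all _ fun q => hC _)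

theorem neg_interpH_eq (ht : t ≤ 1) (hau : 0 ≤ au) (hav : 0 ≤ av) (hR : R ∈ quadrant)
    (U : Fin nu → ℝ) (V : Fin nv → ℝ) (Z : Fin nu → Fin nv → ℝ) (Zt : Fin nu → ℝ)
    (Zb : Fin nv → ℝ) (u : Fin nu → ℝ) (v : Fin nv → ℝ) :
    -interpH n nu nv au av t R.1 R.2 U V Z Zt Zb u v =
      channelExponent (obsStrength n nu nv au av t R)
        (packObs (Z, Zt, Zb) + obsStrength n nu nv au av t R * spikeSignal (U, V))
        (spikeSignal (u, v)) := by
  have h1 : √((1 - t) / n) ^ 2 = (1 - t) / n := sq_sqrt (div_nonneg (by linarith) n.cast_nonneg)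
  have h2 : √(av * R.2) ^ 2 = av * R.2 := sq_sqrt (mul_nonneg hav hR.2)
  have h3 : √(au * R.1) ^ 2 = au * R.1 := sq_sqrt (mul_nonneg hau hR.1)
  simp only [interpH, channelExponent, Fintype.sum_sum_type, Fintype.sum_prod_type, obsStrength,
    spikeSignal, packObs, Sum.elim_inl, Sum.elim_inr, Pi.add_apply, Pi.mul_apply, h1, h2, h3,
    neg_add, ← Finset.sum_neg_distrib, add_assoc]
  refine congrArg₂ (· + ·) ?_ (congrArg₂ (· + ·) ?_ ?_)
  · refine Finset.sum_congr rfl fun i _ => Finset.sum_congr rfl fun j _ => ?_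
    rw [show (1 - t) / (2 * n) = (1 - t) / n / 2 by rw [div_div, mul_comm]]
    ring
  · exact Finset.sum_congr rfl fun i _ => by ring
  · exact Finset.sum_congr rfl fun i _ => by ring

theorem IsUniformSphere.ae_abs_le {N : ℕ} {r : ℝ} {P : Measure (Fin N → ℝ)} (hr : 0 ≤ r)
    (h : IsUniformSphere N r P) : ∀ᵐ x ∂P, ∀ i, |x i| ≤ r := by
  filter_upwards [h.2.1] with x hx i
  rw [← abs_of_nonneg hr]
  refine sq_le_sq.1 (hx ▸ ?_)
  exact Finset.single_le_sum (f := fun i => x i ^ 2) (fun _ _ => sq_nonneg _) (Finset.mem_univ i)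

theorem boundedSignal_spikeSignal {r s : ℝ} (hr : 0 ≤ r) (hs : 0 ≤ s)
    (hPu : IsUniformSphere nu r Pu) (hPv : IsUniformSphere nv s Pv) (j : Fin nv) :
    BoundedSignal (Pu.prod Pv) spikeSignal (fun ω => ω.2 j) ((1 + r) * (1 + s)) := by
  have := hPu.1
  have := hPv.1
  have hu := Measure.quasiMeasurePreserving_fst (μ := Pu) (ν := Pv) |>.ae (hPu.ae_abs_le hr)
  have hv := Measure.quasiMeasurePreserving_snd (μ := Pu) (ν := Pv) |>.ae (hPv.ae_abs_le hs)
  refine ⟨?_, continuous_spikeSignal.measurable, ?_, ?_, ?_⟩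
  · nlinarith [mul_nonneg hr hs]
  · filter_upwards [hu, hv] with ω hωu hωv k
    rcases k with p | i | j <;> simp only [spikeSignal, packObs, Sum.elim_inl, Sum.elim_inr]
    · rw [abs_mul]
      calc _ ≤ r * s := mul_le_mul (hωu _) (hωv _) (abs_nonneg _) hr
        _ ≤ _ := by nlinarith
    · exact (hωu i).trans (by nlinarith)
    · exact (hωv j).trans (by nlinarith)
  · exact (by fun_prop : Continuous fun ω : (Fin nu → ℝ) × (Fin nv → ℝ) =>
      ω.2 j).aestronglyMeasurable
  · filter_upwards [hv] with ω hω
    exact (hω j).trans (by nlinarith)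

theorem integral_exp_neg_interpH [IsProbabilityMeasure Pu] [IsProbabilityMeasure Pv]
    {f g : (Fin nu → ℝ) × (Fin nv → ℝ) → ℝ} {B C : ℝ}
    (h : BoundedSignal (Pu.prod Pv) spikeSignal f B) (hg : IsBoundedBy (Pu.prod Pv) g C)
    (ht : t ≤ 1) (hau : 0 ≤ au) (hav : 0 ≤ av) (hR : R ∈ quadrant) (U : Fin nu → ℝ)
    (V : Fin nv → ℝ) (Z : Fin nu → Fin nv → ℝ) (Zt : Fin nu → ℝ) (Zb : Fin nv → ℝ) :
    ∫ u, ∫ v, g (u, v) * exp (-interpH n nu nv au av t R.1 R.2 U V Z Zt Zb u v) ∂Pv ∂Pu =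
      tiltedIntegral (Pu.prod Pv) spikeSignal g (obsStrength n nu nv au av t R)
        (packObs (Z, Zt, Zb) + obsStrength n nu nv au av t R * spikeSignal (U, V)) := by
  simp only [neg_interpH_eq ht hau hav hR]
  exact (integral_prod _ (h.integrable hg _ _)).symm

theorem gibbs_overlapV_eq [IsProbabilityMeasure Pu] [IsProbabilityMeasure Pv] [NeZero nv]
    {B : ℝ} (h : ∀ j, BoundedSignal (Pu.prod Pv) spikeSignal (fun ω => ω.2 j) B)
    (ht : t ≤ 1) (hau : 0 ≤ au) (hav : 0 ≤ av) (hR : R ∈ quadrant) (U : Fin nu → ℝ)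
    (V : Fin nv → ℝ) (Z : Fin nu → Fin nv → ℝ) (Zt : Fin nu → ℝ) (Zb : Fin nv → ℝ) :
    gibbs n nu nv au av t R.1 R.2 Pu Pv U V Z Zt Zb (fun _ v => overlapV nv v V) =
      1 / (nv : ℝ) * ∑ j, V j * posteriorMean (Pu.prod Pv) spikeSignal (fun ω => ω.2 j)
        (obsStrength n nu nv au av t R)
        (packObs (Z, Zt, Zb) + obsStrength n nu nv au av t R * spikeSignal (U, V)) := by
  have hg : IsBoundedBy (Pu.prod Pv) (fun ω => overlapV nv ω.2 V)
      (|1 / (nv : ℝ)| * ∑ j, B * |V j|) := by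
    refine ⟨(by unfold overlapV; fun_prop : Continuous fun ω : (Fin nu → ℝ) × (Fin nv → ℝ) =>
      overlapV nv ω.2 V).aestronglyMeasurable, ?_⟩
    filter_upwards [ae_all_iff.2 fun j => (h j).ae_le] with ω hω
    rw [overlapV, abs_mul]
    refine mul_le_mul_of_nonneg_left ((Finset.abs_sum_le_sum_abs _ _).trans
      (Finset.sum_le_sum fun j _ => ?_)) (abs_nonneg _)
    rw [abs_mul]
    exact mul_le_mul_of_nonneg_right (hω j) (abs_nonneg _)
  have h1 := integral_exp_neg_interpH (n := n) (h 0) BoundedSignal.isBoundedBy_one ht hau hav hR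
    U V Z Zt Zb
  simp only [one_mul] at h1
  rw [gibbs, partFun, h1, integral_exp_neg_interpH (h 0) hg ht hau hav hR U V Z Zt Zb]
  set s := obsStrength n nu nv au av t R
  set y := packObs (Z, Zt, Zb) + s * spikeSignal (U, V)
  have h2 : tiltedIntegral (Pu.prod Pv) spikeSignal (fun ω => overlapV nv ω.2 V) s y =
      1 / (nv : ℝ) * ∑ j, V j * tiltedIntegral (Pu.prod Pv) spikeSignal (fun ω => ω.2 j) s y := by
    simp only [tiltedIntegral, ← integral_const_mul]
    rw [← integral_finsetSum _ fun j _ => ((h j).integrable (h j).isBoundedBy s y).const_mul (V j),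
      ← integral_const_mul]
    refine integral_congr_ae (ae_of_all _ fun ω => ?_)
    simp only [overlapV, Finset.mul_sum, Finset.sum_mul]
    exact Finset.sum_congr rfl fun j _ => by ring
  rw [h2, mul_div_assoc, Finset.sum_div]
  simp only [posteriorMean, mul_div_assoc]

theorem eQv_eq [IsProbabilityMeasure Pu] [IsProbabilityMeasure Pv] [NeZero nv]
    {B : ℝ} (h : ∀ j, BoundedSignal (Pu.prod Pv) spikeSignal (fun ω => ω.2 j) B)
    (ht : t ≤ 1) (hau : 0 ≤ au) (hav : 0 ≤ av) (hR : R ∈ quadrant) :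
    eQv n nu nv au av t R.1 R.2 Pu Pv = 1 / (nv : ℝ) * ∑ j,
      expectedOverlap (Pu.prod Pv) spikeSignal (fun ω => ω.2 j)
        (obsStrength n nu nv au av t R) := by
  have hB : 0 ≤ B := zero_le_one.trans (h 0).one_le
  simp only [eQv, Efull, gibbs_overlapV_eq h ht hau hav hR]
  set s := obsStrength n nu nv au av t R
  let m : Fin nv → (ObsIndex nu nv → ℝ) → ℝ := fun j =>
    posteriorMean (Pu.prod Pv) spikeSignal (fun ω => ω.2 j) s
  have hm : ∀ j, Continuous (m j) := fun j =>
    BoundedSignal.continuous_section (h j).continuous_posteriorMean s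
  have hm' : ∀ j y, |m j y| ≤ B := fun j y => (h j).abs_posteriorMean_le s y
  have hnoise : ∀ (U : Fin nu → ℝ) (V : Fin nv → ℝ),
      ∫ Z, ∫ Zt, ∫ Zb, 1 / (nv : ℝ) * ∑ j, V j * m j (packObs (Z, Zt, Zb) + s * spikeSignal (U, V))
        ∂stdGaussian nv ∂stdGaussian nu ∂stdGaussianMat nu nv =
      1 / (nv : ℝ) * ∑ j, V j * ∫ z, m j (z + s * spikeSignal (U, V))
        ∂gaussianPi (ObsIndex nu nv) := by
    intro U V
    have hc : ∀ j, Continuous fun z => m j (z + s * spikeSignal (U, V)) := fun j =>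
      (hm j).comp (continuous_add_const _)
    rw [integral_packObs (C := |1 / (nv : ℝ)| * ∑ j, |V j| * B)
      (F := fun z => 1 / (nv : ℝ) * ∑ j, V j * m j (z + s * spikeSignal (U, V)))
      (by fun_prop) fun y => ?_, integral_const_mul, integral_finsetSum]
    · simp only [integral_const_mul]
    · exact fun j _ => (Integrable.of_bound (hc j).aestronglyMeasurable B
        (ae_of_all _ fun y => hm' j _)).const_mul (V j)
    · rw [abs_mul]
      refine mul_le_mul_of_nonneg_left ((Finset.abs_sum_le_sum_abs _ _).trans
        (Finset.sum_le_sum fun j _ => ?_)) (abs_nonneg _)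
      rw [abs_mul]
      exact mul_le_mul_of_nonneg_left (hm' j _) (abs_nonneg _)
  have hint : ∀ j, Integrable (fun ω : (Fin nu → ℝ) × (Fin nv → ℝ) =>
      ω.2 j * ∫ z, m j (z + s * spikeSignal ω) ∂gaussianPi (ObsIndex nu nv)) (Pu.prod Pv) := by
    intro j
    have hc : Continuous fun q : ((Fin nu → ℝ) × (Fin nv → ℝ)) × (ObsIndex nu nv → ℝ) =>
        m j (q.2 + s * spikeSignal q.1) :=
      (hm j).comp (continuous_snd.add
        (continuous_const.mul (continuous_spikeSignal.comp continuous_fst)))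
    refine .of_bound ((h j).aestronglyMeasurable.mul
      hc.stronglyMeasurable.integral_prod_right'.aestronglyMeasurable) (B * B) ?_
    filter_upwards [(h j).ae_le] with ω hω
    rw [norm_mul]
    refine mul_le_mul hω ?_ (norm_nonneg _) hB
    simpa using norm_integral_le_of_norm_le_const (μ := gaussianPi (ObsIndex nu nv))
      (f := fun z => m j (z + s * spikeSignal ω)) (C := B)
      (ae_of_all _ fun z => hm' j (z + s * spikeSignal ω))
  calc _ = ∫ U, ∫ V, 1 / (nv : ℝ) * ∑ j, V j * ∫ z, m j (z + s * spikeSignal (U, V))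
        ∂gaussianPi (ObsIndex nu nv) ∂Pv ∂Pu :=
        integral_congr_ae (ae_of_all _ fun U => integral_congr_ae (ae_of_all _ (hnoise U)))
    _ = ∫ ω, 1 / (nv : ℝ) * ∑ j, ω.2 j * ∫ z, m j (z + s * spikeSignal ω)
        ∂gaussianPi (ObsIndex nu nv) ∂(Pu.prod Pv) :=
        (integral_prod _ ((integrable_finsetSum _ fun j _ => hint j).const_mul _)).symm
    _ = _ := by
        rw [integral_const_mul, integral_finsetSum _ fun j _ => hint j]
        exact congrArg _ (Finset.sum_congr rfl fun j _ => (h j).integral_mul_posteriorMean s)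

/-- The expected overlap `E⟨Q_v⟩` of the interpolating model, as a function on all of `ℝ × ℝ²`. -/
def meanOverlap (n : ℕ) (au av : ℝ) (Pu : Measure (Fin nu → ℝ)) (Pv : Measure (Fin nv → ℝ))
    (t : ℝ) (R : ℝ × ℝ) : ℝ :=
  1 / (nv : ℝ) * ∑ j, expectedOverlap (Pu.prod Pv) spikeSignal (fun ω => ω.2 j)
    (obsStrength n nu nv au av t R)

/-- The partial derivative of `meanOverlap` in `R_u`. -/
def meanOverlapDerivFst (n : ℕ) (au av : ℝ) (Pu : Measure (Fin nu → ℝ))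
    (Pv : Measure (Fin nv → ℝ)) (t : ℝ) (R : ℝ × ℝ) : ℝ :=
  1 / (nv : ℝ) * ∑ j : Fin nv, au * ∑ k : Fin nv, expectedSqCovariance (Pu.prod Pv) spikeSignal
    (fun ω => ω.2 j) (.inr (.inr k)) (obsStrength n nu nv au av t R)

/-- The partial derivative of `meanOverlap` in `R_v`. -/
def meanOverlapDerivSnd (n : ℕ) (au av : ℝ) (Pu : Measure (Fin nu → ℝ))
    (Pv : Measure (Fin nv → ℝ)) (t : ℝ) (R : ℝ × ℝ) : ℝ :=
  1 / (nv : ℝ) * ∑ j : Fin nv, av * ∑ i : Fin nu, expectedSqCovariance (Pu.prod Pv) spikeSignal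
    (fun ω => ω.2 j) (.inr (.inl i)) (obsStrength n nu nv au av t R)

theorem hasFDerivWithinAt_quadrant_of_interior {f : ℝ × ℝ → ℝ} {f' : ℝ × ℝ → (ℝ × ℝ) →L[ℝ] ℝ}
    (hf : Continuous f) (hf' : Continuous f')
    (h : ∀ R : ℝ × ℝ, 0 < R.1 → 0 < R.2 → HasFDerivAt f (f' R) R) (R : ℝ × ℝ) :
    HasFDerivWithinAt f (f' R) quadrant R := by
  have hcl : closure (Ioi (0 : ℝ) ×ˢ Ioi (0 : ℝ)) = quadrant := by
    rw [closure_prod_eq, closure_Ioi]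
    ext p
    simp [quadrant, Prod.le_def]
  rw [← hcl]
  refine hasFDerivWithinAt_closure_of_tendsto_fderiv
    (fun p hp => (h p hp.1 hp.2).differentiableAt.differentiableWithinAt)
    ((convex_Ioi _).prod (convex_Ioi _)) (isOpen_Ioi.prod isOpen_Ioi)
    (fun p _ => hf.continuousWithinAt) ?_
  refine (hf'.continuousAt.mono_left nhdsWithin_le_nhds).congr' ?_
  filter_upwards [self_mem_nhdsWithin] with p hp
  exact (h p hp.1 hp.2).fderiv.symm

theorem hasFDerivAt_expectedOverlap_obsStrength [IsProbabilityMeasure Pu]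
    [IsProbabilityMeasure Pv] {f : (Fin nu → ℝ) × (Fin nv → ℝ) → ℝ} {B : ℝ}
    (h : BoundedSignal (Pu.prod Pv) spikeSignal f B) (hau : 0 < au) (hav : 0 < av)
    (h1 : 0 < R.1) (h2 : 0 < R.2) :
    HasFDerivAt (fun R => expectedOverlap (Pu.prod Pv) spikeSignal f
        (obsStrength n nu nv au av t R))
      ((au * ∑ k, expectedSqCovariance (Pu.prod Pv) spikeSignal f (.inr (.inr k))
          (obsStrength n nu nv au av t R)) • ContinuousLinearMap.fst ℝ ℝ ℝ +
        (av * ∑ i, expectedSqCovariance (Pu.prod Pv) spikeSignal f (.inr (.inl i))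
          (obsStrength n nu nv au av t R)) • ContinuousLinearMap.snd ℝ ℝ ℝ) R := by
  let L : ObsIndex nu nv → (ℝ × ℝ) →L[ℝ] ℝ := Sum.elim (fun _ => 0)
    (Sum.elim (fun _ => (1 / (2 * √(av * R.2))) • av • ContinuousLinearMap.snd ℝ ℝ ℝ)
      (fun _ => (1 / (2 * √(au * R.1))) • au • ContinuousLinearMap.fst ℝ ℝ ℝ))
  have hL : HasFDerivAt (obsStrength n nu nv au av t) (ContinuousLinearMap.pi L) R := by
    refine hasFDerivAt_pi.2 fun k => ?_
    rcases k with p | i | j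
    · exact hasFDerivAt_const _ _
    · exact (hasFDerivAt_snd.const_mul av).sqrt (mul_pos hav h2).ne'
    · exact (hasFDerivAt_fst.const_mul au).sqrt (mul_pos hau h1).ne'
  have hu : √(au * R.1) ≠ 0 := (sqrt_pos.2 (mul_pos hau h1)).ne'
  have hv : √(av * R.2) ≠ 0 := (sqrt_pos.2 (mul_pos hav h2)).ne'
  refine ((h.hasFDerivAt_expectedOverlap _).comp R hL).congr_fderiv ?_
  ext
  · simp [L, obsStrength, packObs, Finset.mul_sum]
    refine Finset.sum_congr rfl fun k _ => ?_
    field_simp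
  · simp [L, obsStrength, packObs, Finset.mul_sum]
    refine Finset.sum_congr rfl fun k _ => ?_
    field_simp

section Regularity

variable [IsProbabilityMeasure Pu] [IsProbabilityMeasure Pv] {B : ℝ}

theorem continuous_meanOverlap
    (h : ∀ j, BoundedSignal (Pu.prod Pv) spikeSignal (fun ω => ω.2 j) B) :
    Continuous fun p : ℝ × (ℝ × ℝ) => meanOverlap n au av Pu Pv p.1 p.2 :=
  (continuous_finsetSum _ fun j _ =>
    (h j).continuous_expectedOverlap.comp continuous_obsStrength).const_mul _

theorem continuous_meanOverlapDerivFst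
    (h : ∀ j, BoundedSignal (Pu.prod Pv) spikeSignal (fun ω => ω.2 j) B) :
    Continuous fun p : ℝ × (ℝ × ℝ) => meanOverlapDerivFst n au av Pu Pv p.1 p.2 :=
  (continuous_finsetSum _ fun j _ => (continuous_finsetSum _ fun _ _ =>
    ((h j).continuous_expectedSqCovariance _).comp continuous_obsStrength).const_mul _).const_mul _

theorem continuous_meanOverlapDerivSnd
    (h : ∀ j, BoundedSignal (Pu.prod Pv) spikeSignal (fun ω => ω.2 j) B) :
    Continuous fun p : ℝ × (ℝ × ℝ) => meanOverlapDerivSnd n au av Pu Pv p.1 p.2 :=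
  (continuous_finsetSum _ fun j _ => (continuous_finsetSum _ fun _ _ =>
    ((h j).continuous_expectedSqCovariance _).comp continuous_obsStrength).const_mul _).const_mul _

theorem meanOverlap_nonneg
    (h : ∀ j, BoundedSignal (Pu.prod Pv) spikeSignal (fun ω => ω.2 j) B) :
    0 ≤ meanOverlap n au av Pu Pv t R :=
  mul_nonneg (by positivity) (Finset.sum_nonneg fun j _ => (h j).expectedOverlap_nonneg _)

theorem meanOverlap_le [NeZero nv]
    (h : ∀ j, BoundedSignal (Pu.prod Pv) spikeSignal (fun ω => ω.2 j) B) {r : ℝ}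
    (hr : ∀ᵐ v ∂Pv, ∑ j, v j ^ 2 = r * nv) : meanOverlap n au av Pu Pv t R ≤ r := by
  have := BoundedSignal.sum_expectedOverlap_le h 0
    (Measure.quasiMeasurePreserving_snd (μ := Pu) (ν := Pv) |>.ae hr)
    (obsStrength n nu nv au av t R)
  have hnv : (0 : ℝ) < nv := Nat.cast_pos.2 (NeZero.pos nv)
  rwa [meanOverlap, one_div, inv_mul_le_iff₀ hnv, mul_comm (nv : ℝ)]

theorem meanOverlapDerivFst_nonneg
    (h : ∀ j, BoundedSignal (Pu.prod Pv) spikeSignal (fun ω => ω.2 j) B) (hau : 0 ≤ au) :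
    0 ≤ meanOverlapDerivFst n au av Pu Pv t R :=
  mul_nonneg (by positivity) (Finset.sum_nonneg fun j _ => mul_nonneg hau
    (Finset.sum_nonneg fun _ _ => (h j).expectedSqCovariance_nonneg _ _))

theorem meanOverlapDerivSnd_nonneg
    (h : ∀ j, BoundedSignal (Pu.prod Pv) spikeSignal (fun ω => ω.2 j) B) (hav : 0 ≤ av) :
    0 ≤ meanOverlapDerivSnd n au av Pu Pv t R :=
  mul_nonneg (by positivity) (Finset.sum_nonneg fun j _ => mul_nonneg hav
    (Finset.sum_nonneg fun _ _ => (h j).expectedSqCovariance_nonneg _ _))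

theorem meanOverlapDerivFst_le
    (h : ∀ j, BoundedSignal (Pu.prod Pv) spikeSignal (fun ω => ω.2 j) B) (hau : 0 ≤ au) :
    meanOverlapDerivFst n au av Pu Pv t R ≤
      1 / (nv : ℝ) * ∑ _j : Fin nv, au * ∑ _k : Fin nv, 4 * B ^ 4 := by
  unfold meanOverlapDerivFst
  gcongr with j _ k
  exact (h j).expectedSqCovariance_le _ _

theorem meanOverlapDerivSnd_le
    (h : ∀ j, BoundedSignal (Pu.prod Pv) spikeSignal (fun ω => ω.2 j) B) (hav : 0 ≤ av) :
    meanOverlapDerivSnd n au av Pu Pv t R ≤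
      1 / (nv : ℝ) * ∑ _j : Fin nv, av * ∑ _i : Fin nu, 4 * B ^ 4 := by
  unfold meanOverlapDerivSnd
  gcongr with j _ k
  exact (h j).expectedSqCovariance_le _ _

theorem hasFDerivWithinAt_meanOverlap
    (h : ∀ j, BoundedSignal (Pu.prod Pv) spikeSignal (fun ω => ω.2 j) B)
    (hau : 0 < au) (hav : 0 < av) :
    HasFDerivWithinAt (meanOverlap n au av Pu Pv t)
      (meanOverlapDerivFst n au av Pu Pv t R • ContinuousLinearMap.fst ℝ ℝ ℝ +
        meanOverlapDerivSnd n au av Pu Pv t R • ContinuousLinearMap.snd ℝ ℝ ℝ) quadrant R := by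
  refine hasFDerivWithinAt_quadrant_of_interior
    (f' := fun R => meanOverlapDerivFst n au av Pu Pv t R • ContinuousLinearMap.fst ℝ ℝ ℝ +
        meanOverlapDerivSnd n au av Pu Pv t R • ContinuousLinearMap.snd ℝ ℝ ℝ)
    ((continuous_meanOverlap h).comp (.prodMk_right t))
    ((((continuous_meanOverlapDerivFst h).comp (.prodMk_right t)).smul continuous_const).add
      (((continuous_meanOverlapDerivSnd h).comp (.prodMk_right t)).smul continuous_const))
    (fun R h1 h2 => ?_) R
  refine ((HasFDerivAt.fun_sum fun j _ =>
    hasFDerivAt_expectedOverlap_obsStrength (h j) hau hav h1 h2).const_mul _).congr_fderiv ?_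
  rw [Finset.sum_add_distrib, ← Finset.sum_smul, ← Finset.sum_smul, smul_add, smul_smul, smul_smul]
  rfl

end Regularity

end RankOne

/-! ### The interpolation vector fields -/

theorem hasDerivAt_phi0' {m : ℝ} (hm : 0 ≤ m) : HasDerivAt phi0' (1 / (2 * (1 + m) ^ 2)) m := by
  have h : HasDerivAt (fun m : ℝ => 2 * (1 + m)) 2 m := by
    simpa using ((hasDerivAt_id m).const_add 1).const_mul 2
  refine ((hasDerivAt_id m).div h (by positivity)).congr_deriv ?_
  simp only [id]
  field_simp
  ring

theorem phi0'_nonneg {m : ℝ} (hm : 0 ≤ m) : 0 ≤ phi0' m := by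
  unfold phi0'
  positivity

theorem two_mul_phi0'_le_one {m : ℝ} (hm : 0 ≤ m) : 2 * phi0' m ≤ 1 := by
  unfold phi0'
  rw [mul_div_assoc', div_le_one (by positivity)]
  linarith

theorem odeConclusion_of_fderiv_smul {pu pv C K₁ K₂ : ℝ} {p q c q₁ q₂ : ℝ → ℝ × ℝ → ℝ}
    (hp : Continuous (Function.uncurry p)) (hq : Continuous (Function.uncurry q))
    (hc : Continuous (Function.uncurry c)) (hq₁ : Continuous (Function.uncurry q₁))
    (hq₂ : Continuous (Function.uncurry q₂)) (hpm : ∀ t R, p t R ∈ Icc 0 pu)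
    (hqm : ∀ t R, q t R ∈ Icc 0 pv) (hcm : ∀ t R, c t R ∈ Icc 0 C)
    (hq₁m : ∀ t R, q₁ t R ∈ Icc 0 K₁) (hq₂m : ∀ t R, q₂ t R ∈ Icc 0 K₂)
    (hdq : ∀ t R, HasFDerivWithinAt (q t) (q₁ t R • ContinuousLinearMap.fst ℝ ℝ ℝ +
      q₂ t R • ContinuousLinearMap.snd ℝ ℝ ℝ) quadrant R)
    (hdp : ∀ t R, HasFDerivWithinAt (p t) (c t R • (q₁ t R • ContinuousLinearMap.fst ℝ ℝ ℝ +
      q₂ t R • ContinuousLinearMap.snd ℝ ℝ ℝ)) quadrant R) :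
    ODEConclusion pu pv fun t R => (p t R, q t R) := by
  let Q : ℝ → ℝ × ℝ → (ℝ × ℝ) →L[ℝ] ℝ := fun t R =>
    q₁ t R • ContinuousLinearMap.fst ℝ ℝ ℝ + q₂ t R • ContinuousLinearMap.snd ℝ ℝ ℝ
  have hQ : Continuous (Function.uncurry Q) :=
    (hq₁.smul continuous_const).add (hq₂.smul continuous_const)
  have hQn : ∀ t R, ‖Q t R‖ ≤ K₁ + K₂ := fun t R => by
    refine (norm_add_le _ _).trans (add_le_add ?_ ?_) <;>
      rw [norm_smul, norm_eq_abs]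
    · rw [abs_of_nonneg (hq₁m t R).1]
      exact (mul_le_of_le_one_right (hq₁m t R).1 (ContinuousLinearMap.norm_fst_le ℝ ℝ ℝ)).trans
        (hq₁m t R).2
    · rw [abs_of_nonneg (hq₂m t R).1]
      exact (mul_le_of_le_one_right (hq₂m t R).1 (ContinuousLinearMap.norm_snd_le ℝ ℝ ℝ)).trans
        (hq₂m t R).2
  have hK : 0 ≤ K₁ + K₂ := (norm_nonneg _).trans (hQn 0 0)
  have hC : 0 ≤ C := (hcm 0 0).1.trans (hcm 0 0).2
  have hCK : 0 ≤ (C + 1) * (K₁ + K₂) := mul_nonneg (by linarith) hK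
  refine QuadrantField.odeConclusion (DG := fun t R => (c t R • Q t R).prod (Q t R))
    (K := ⟨(C + 1) * (K₁ + K₂), hCK⟩)
    ⟨hp.prodMk hq, fun t R => ⟨hpm t R, hqm t R⟩, fun t R _ => (hdp t R).prodMk (hdq t R),
      (ContinuousLinearMap.prodₗᵢ ℝ).continuous.comp ((hc.smul hQ).prodMk hQ),
      fun t R => ?_, fun t R => ?_⟩
  · refine ContinuousLinearMap.opNorm_le_bound _ hCK fun v => ?_
    have h1 : ‖Q t R v‖ ≤ (K₁ + K₂) * ‖v‖ := (Q t R).le_of_opNorm_le (hQn t R) v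
    have h2 : ‖c t R • Q t R v‖ ≤ C * ((K₁ + K₂) * ‖v‖) := by
      rw [norm_smul, norm_eq_abs, abs_of_nonneg (hcm t R).1]
      exact mul_le_mul (hcm t R).2 h1 (norm_nonneg _) hC
    have h3 : 0 ≤ (K₁ + K₂) * ‖v‖ := mul_nonneg hK (norm_nonneg v)
    have h4 : 0 ≤ C * ((K₁ + K₂) * ‖v‖) := mul_nonneg hC h3
    change max ‖c t R • Q t R v‖ ‖Q t R v‖ ≤ (C + 1) * (K₁ + K₂) * ‖v‖
    refine max_le ?_ ?_ <;> linarith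
  · have h1 := mul_nonneg (hcm t R).1 (hq₁m t R).1
    have h2 := (hq₂m t R).1
    simpa [Q] using add_nonneg h1 h2

theorem odeConclusion_of_overlap {av ru rv K₁ K₂ : ℝ} {q q₁ q₂ : ℝ → ℝ × ℝ → ℝ}
    (hav : 0 ≤ av) (hru : 0 ≤ ru)
    (hq : Continuous (Function.uncurry q)) (hq₁ : Continuous (Function.uncurry q₁))
    (hq₂ : Continuous (Function.uncurry q₂)) (hqm : ∀ t R, q t R ∈ Icc 0 rv)
    (hq₁m : ∀ t R, q₁ t R ∈ Icc 0 K₁) (hq₂m : ∀ t R, q₂ t R ∈ Icc 0 K₂)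
    (hdq : ∀ t R, HasFDerivWithinAt (q t) (q₁ t R • ContinuousLinearMap.fst ℝ ℝ ℝ +
      q₂ t R • ContinuousLinearMap.snd ℝ ℝ ℝ) quadrant R) :
    ODEConclusion ru rv (fun t R => (2 * ru * phi0' (av * ru * q t R), q t R)) ∧
      ∀ mu ∈ Icc (0 : ℝ) ru, ODEConclusion ru rv fun t R => (mu, q t R) := by
  have har : 0 ≤ av * ru := mul_nonneg hav hru
  have hm : ∀ t R, 0 ≤ av * ru * q t R := fun t R => mul_nonneg har (hqm t R).1
  constructor
  · have hden : ∀ x : ℝ × (ℝ × ℝ), 1 + av * ru * Function.uncurry q x ≠ 0 := fun x =>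
      (by linarith [hm x.1 x.2] : 0 < 1 + av * ru * q x.1 x.2).ne'
    refine odeConclusion_of_fderiv_smul (C := 2 * ru * (av * ru))
      (c := fun t R => 2 * ru * (1 / (2 * (1 + av * ru * q t R) ^ 2) * (av * ru))) ?_ hq ?_ hq₁ hq₂
      (fun t R => ⟨?_, ?_⟩) hqm (fun t R => ⟨?_, ?_⟩) hq₁m hq₂m hdq fun t R => ?_
    · refine continuous_const.mul ((continuous_const.mul hq).div
        (continuous_const.mul (continuous_const.add (continuous_const.mul hq))) fun x => ?_)
      exact mul_ne_zero two_ne_zero (hden x)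
    · refine continuous_const.mul ((continuous_const.div (continuous_const.mul
        ((continuous_const.add (continuous_const.mul hq)).pow 2)) fun x => ?_).mul
          continuous_const)
      exact mul_ne_zero two_ne_zero (pow_ne_zero 2 (hden x))
    · exact mul_nonneg (by positivity) (phi0'_nonneg (hm t R))
    · calc 2 * ru * phi0' (av * ru * q t R) = ru * (2 * phi0' (av * ru * q t R)) := by ring
        _ ≤ ru := mul_le_of_le_one_right hru (two_mul_phi0'_le_one (hm t R))
    · positivity
    · have h1 : 1 / (2 * (1 + av * ru * q t R) ^ 2) ≤ 1 := by
        have := hm t R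
        rw [div_le_one (by positivity)]
        nlinarith
      exact mul_le_mul_of_nonneg_left (mul_le_of_le_one_left har h1) (by positivity)
    · refine (((hasDerivAt_phi0' (hm t R)).comp_hasFDerivWithinAt R
        ((hdq t R).const_mul (av * ru))).const_mul (2 * ru)).congr_fderiv ?_
      simp only [smul_smul, mul_assoc]
  · intro mu hmu
    refine odeConclusion_of_fderiv_smul (C := 0) (c := fun _ _ => 0) continuous_const hq
      continuous_const hq₁ hq₂ (fun _ _ => hmu) hqm (fun _ _ => ⟨le_rfl, le_rfl⟩) hq₁m hq₂m hdq
      fun t R => ?_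
    rw [zero_smul]
    exact hasFDerivWithinAt_const _ _ _

/-- **Proposition 2: interpolation paths as ODE solutions.**
With `F_v(t,R) = E⟨Q_v⟩_{t,R}` and `F_u(t,R) = 2ρ_u φ₀'(α_vρ_u E⟨Q_v⟩_{t,R})`, the
ODE `g' = (F_u(t,g), F_v(t,g))`, `g(0) = ε` has for every `ε ∈ [0,∞)²` a unique
global `C¹` solution `[0,1] → [0,∞)²` with derivative in `[0,ρ_u] × [0,ρ_v]`, and
for each `t ∈ [0,1]` the flow `ε ↦ R(t,ε)` is a `C¹`-diffeomorphism onto its image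
with Jacobian determinant `≥ 1`. The same holds for the ODE
`g' = (m_u, F_v(t,g))` for any fixed `m_u ∈ [0,ρ_u]`. -/
theorem interpolation_paths_ode
    (n nu nv : ℕ) (hn : 0 < n) (hnu : 0 < nu) (hnv : 0 < nv)
    (au av ru rv : ℝ) (hau : 0 < au) (hav : 0 < av) (hru : 0 < ru) (hrv : 0 < rv)
    (Pu : Measure (Fin nu → ℝ)) (Pv : Measure (Fin nv → ℝ))
    (hPu : IsUniformSphere nu (Real.sqrt (ru * nu)) Pu)
    (hPv : IsUniformSphere nv (Real.sqrt (rv * nv)) Pv) :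
    ODEConclusion ru rv (fun t R =>
      (2 * ru * phi0' (av * ru * eQv n nu nv au av t R.1 R.2 Pu Pv),
        eQv n nu nv au av t R.1 R.2 Pu Pv)) ∧
    ∀ mu ∈ Icc (0:ℝ) ru,
      ODEConclusion ru rv (fun t R =>
        (mu, eQv n nu nv au av t R.1 R.2 Pu Pv)) := by
  have : NeZero nv := ⟨hnv.ne'⟩
  have := hPu.1
  have := hPv.1
  have h := boundedSignal_spikeSignal (sqrt_nonneg _) (sqrt_nonneg _) hPu hPv
  have hr : ∀ᵐ v ∂Pv, ∑ j, v j ^ 2 = rv * nv := by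
    filter_upwards [hPv.2.1] with v hv
    rw [hv, sq_sqrt (by positivity)]
  have key := odeConclusion_of_overlap hav.le hru.le
    (q := meanOverlap n au av Pu Pv) (q₁ := meanOverlapDerivFst n au av Pu Pv)
    (q₂ := meanOverlapDerivSnd n au av Pu Pv) (continuous_meanOverlap h)
    (continuous_meanOverlapDerivFst h) (continuous_meanOverlapDerivSnd h)
    (fun t R => ⟨meanOverlap_nonneg h, meanOverlap_le h hr⟩)
    (fun t R => ⟨meanOverlapDerivFst_nonneg h hau.le, meanOverlapDerivFst_le h hau.le⟩)
    (fun t R => ⟨meanOverlapDerivSnd_nonneg h hav.le, meanOverlapDerivSnd_le h hav.le⟩)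
    fun t R => hasFDerivWithinAt_meanOverlap h hau hav
  have heq : ∀ t ∈ Icc (0 : ℝ) 1, ∀ R ∈ quadrant,
      eQv n nu nv au av t R.1 R.2 Pu Pv = meanOverlap n au av Pu Pv t R :=
    fun t ht R hR => eQv_eq h ht.2 hau.le hav.le hR
  exact ⟨key.1.congr fun t ht R hR => by rw [heq t ht R hR],
    fun mu hmu => (key.2 mu hmu).congr fun t ht R hR => by rw [heq t ht R hR]⟩

end
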